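/- arXiv:0808.1281 — 2 statements merged into one kernel-verified Lean document; each statement's English description precedes it below -/
import Mathlib

section
/- Let L and L' be flat-at-infinity planar Lagrangians, let a ∈ ℝ, and suppose both L and L' are transverse to {y₂ = a} and L ∩ {y₂ = a} = L' ∩ {y₂ = a} = S. Then for every ε > 0 there exist sets V ⊆ U ⊆ L, each open in the subspace topology of L and each containing S, and an infinitely differentiable map Φ : ℝ × ℝ⁴ → ℝ⁴ such that: Φ(0, ·) is the identity; Φ(t, ·) is a symplectomorphism of ℝ⁴ for every t; Φ(t, p) = p for every t and every p ∈ S ∪ (L ∖ U); Φ(1, ·)(U) ⊆ {p : a − ε < y₂(p) < a + ε}; and Φ(1, ·)(V) ⊆ L'. (Lemma: equivalence of collar neighborhoods of a common slice.) -/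
noncomputable section

/-- ℝ⁴ with coordinates (x₁, x₂, y₁, y₂). -/
abbrev R4 := ℝ × ℝ × ℝ × ℝ
/-- ℝ² with coordinates (x₁, y₁). -/
abbrev R2 := ℝ × ℝ
/-- ℝ³ with coordinates (x₁, x₂, y₁). -/
abbrev R3 := ℝ × ℝ × ℝ

/-- The standard symplectic form ω(u,v) = u₁v₃ − u₃v₁ + u₂v₄ − u₄v₂ on ℝ⁴. -/
def omega4 (u v : R4) : ℝ :=
  u.1 * v.2.2.1 - u.2.2.1 * v.1 + u.2.1 * v.2.2.2 - u.2.2.2 * v.2.1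

/-- A symplectomorphism of ℝ⁴. -/
def IsSymplectomorphism (ψ : R4 → R4) : Prop :=
  Function.Bijective ψ ∧ ContDiff ℝ (⊤ : ℕ∞) ψ ∧ ContDiff ℝ (⊤ : ℕ∞) (Function.invFun ψ) ∧
  ∀ p u v : R4, omega4 (fderiv ℝ ψ p u) (fderiv ℝ ψ p v) = omega4 u v

/-- The Hamiltonian vector field of H : ℝ⁴ → ℝ, coordinates (x₁, x₂, y₁, y₂). -/
def HamVF (H : R4 → ℝ) (p : R4) : R4 :=
  (fderiv ℝ H p (0, 0, 1, 0), fderiv ℝ H p (0, 0, 0, 1),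
   -fderiv ℝ H p (1, 0, 0, 0), -fderiv ℝ H p (0, 1, 0, 0))

/-- A global Hamiltonian flow of H on ℝ⁴. -/
def IsHamFlow (H : R4 → ℝ) (Φ : ℝ × R4 → R4) : Prop :=
  ContDiff ℝ (⊤ : ℕ∞) Φ ∧ (∀ p, Φ (0, p) = p) ∧
  ∀ (t : ℝ) (p : R4), HasDerivAt (fun s => Φ (s, p)) (HamVF H (Φ (t, p))) t

/-- A parametrization of a flat-at-infinity planar Lagrangian. -/
def IsFlatParam (f : R2 → R4) : Prop :=
  ContDiff ℝ (⊤ : ℕ∞) f ∧ Function.Injective f ∧ IsProperMap f ∧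
  (∀ p : R2, Function.Injective (fderiv ℝ f p)) ∧
  (∀ (p : R2) (u v : R2), omega4 (fderiv ℝ f p u) (fderiv ℝ f p v) = 0) ∧
  ∃ K : Set R2, IsCompact K ∧ ∀ p : R2, p ∉ K → f p = (p.1, p.2, 0, 0)

/-- A flat-at-infinity planar Lagrangian. -/
def IsFlatLagrangian (L : Set R4) : Prop :=
  ∃ f : R2 → R4, IsFlatParam f ∧ Set.range f = L

/-- `L` is transverse to the hyperplane {y₂ = a}. -/
def TransverseAt (L : Set R4) (a : ℝ) : Prop :=
  ∃ f : R2 → R4, IsFlatParam f ∧ Set.range f = L ∧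
    ∀ p : R2, (f p).2.2.2 = a → fderiv ℝ (fun q => (f q).2.2.2) p ≠ 0

/-- An area-preserving diffeomorphism of ℝ². -/
def IsAreaDiffeo (φ : R2 → R2) : Prop :=
  Function.Bijective φ ∧ ContDiff ℝ (⊤ : ℕ∞) φ ∧ ContDiff ℝ (⊤ : ℕ∞) (Function.invFun φ) ∧
  ∀ p : R2, LinearMap.det ((fderiv ℝ φ p) : R2 →ₗ[ℝ] R2) = 1

/-- φ equals the identity outside a compact set. -/
def IsCompactSupported (φ : R2 → R2) : Prop :=
  ∃ K : Set R2, IsCompact K ∧ ∀ p : R2, p ∉ K → φ p = p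

/-- φ × id : ℝ³ → ℝ³. -/
def phiTimesId (φ : R2 → R2) (p : R3) : R3 :=
  ((φ (p.1, p.2.2)).1, p.2.1, (φ (p.1, p.2.2)).2)

/-- The inclusion i_a : ℝ³ → ℝ⁴. -/
def iMap (a : ℝ) (p : R3) : R4 := (p.1, p.2.1, p.2.2, a)

/-- S ◁ S' : strict Lagrange cobordism relation. -/
def SliceRelStrict (S S' : Set R3) : Prop :=
  ∃ (L : Set R4) (a b : ℝ), a < b ∧ b < 0 ∧ IsFlatLagrangian L ∧
    TransverseAt L a ∧ TransverseAt L b ∧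
    L ∩ {p : R4 | p.2.2.2 = a} = iMap a '' S ∧
    L ∩ {p : R4 | p.2.2.2 = b} = iMap b '' S'

/-- S ⊴ S' : non-strict Lagrange cobordism relation. -/
def SliceRel (S S' : Set R3) : Prop :=
  ∃ (L : Set R4) (a b : ℝ), a ≤ b ∧ b < 0 ∧ IsFlatLagrangian L ∧
    TransverseAt L a ∧ TransverseAt L b ∧
    L ∩ {p : R4 | p.2.2.2 = a} = iMap a '' S ∧
    L ∩ {p : R4 | p.2.2.2 = b} = iMap b '' S'

/-- S ∼ S' : equivalence of slices. -/
def SliceEquiv (S S' : Set R3) : Prop :=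
  ∃ φ : R2 → R2, IsAreaDiffeo φ ∧ IsCompactSupported φ ∧ phiTimesId φ '' S = S'

/-- A negative slice. -/
def IsNegativeSlice (S : Set R3) : Prop :=
  ∃ (L : Set R4) (a : ℝ), a < 0 ∧ IsFlatLagrangian L ∧ TransverseAt L a ∧
    L ∩ {p : R4 | p.2.2.2 = a} = iMap a '' S
/-- Time-dependent Hamiltonian vector field on ℝ⁴. -/
def HamVF4t (H : ℝ × R4 → ℝ) (t : ℝ) (p : R4) : R4 :=
  (fderiv ℝ (fun q => H (t, q)) p (0, 0, 1, 0),
   fderiv ℝ (fun q => H (t, q)) p (0, 0, 0, 1),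
   -fderiv ℝ (fun q => H (t, q)) p (1, 0, 0, 0),
   -fderiv ℝ (fun q => H (t, q)) p (0, 1, 0, 0))

/-- A global Hamiltonian flow of a time-dependent Hamiltonian on ℝ⁴. -/
def IsHamFlow4t (H : ℝ × R4 → ℝ) (Φ : ℝ × R4 → R4) : Prop :=
  ContDiff ℝ (⊤ : ℕ∞) Φ ∧ (∀ p, Φ (0, p) = p) ∧
  ∀ (t : ℝ) (p : R4), HasDerivAt (fun s => Φ (s, p)) (HamVF4t H t (Φ (t, p))) t

/-- Time-dependent Hamiltonian vector field on ℝ², coordinates (x₁, y₁). -/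
def HamVF2t (H : ℝ × R2 → ℝ) (t : ℝ) (q : R2) : R2 :=
  (fderiv ℝ (fun r => H (t, r)) q (0, 1), -fderiv ℝ (fun r => H (t, r)) q (1, 0))

/-- A global Hamiltonian flow of a time-dependent Hamiltonian on ℝ². -/
def IsHamFlow2t (H : ℝ × R2 → ℝ) (φ : ℝ × R2 → R2) : Prop :=
  ContDiff ℝ (⊤ : ℕ∞) φ ∧ (∀ q, φ (0, q) = q) ∧
  ∀ (t : ℝ) (q : R2), HasDerivAt (fun s => φ (s, q)) (HamVF2t H t (φ (t, q))) t

/-- Translation of ℝ⁴ by s in the x₁-direction. -/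
def trX1 (s : ℝ) (p : R4) : R4 := (p.1 + s, p.2.1, p.2.2.1, p.2.2.2)

/-- Φ_φ : ℝ⁴ → ℝ⁴ induced by an area-preserving diffeomorphism φ of the x₁y₁-plane. -/
def PhiPhi (φ : R2 → R2) (p : R4) : R4 :=
  ((φ (p.1, p.2.2.1)).1, p.2.1, (φ (p.1, p.2.2.1)).2, p.2.2.2)
open scoped ContDiff Topology
open Filter

section general
variable {E : Type*} [NormedAddCommGroup E] [NormedSpace ℝ E] [FiniteDimensional ℝ E]

lemma exists_equiv_of_inj (T : E →L[ℝ] E) (h : Function.Injective T) :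
    ∃ e : E ≃L[ℝ] E, (e : E →L[ℝ] E) = T := by
  refine ⟨(LinearEquiv.ofInjectiveEndo (T : E →ₗ[ℝ] E) h).toContinuousLinearEquiv, ?_⟩
  ext x
  rfl

lemma local_inv (A : E → E) (hA : ContDiff ℝ ∞ A) (x : E)
    (hinj : Function.Injective (fderiv ℝ A x)) :
    ∃ l : E → E, ContDiffAt ℝ ∞ l (A x) ∧ l (A x) = x ∧ (∀ᶠ y in 𝓝 (A x), A (l y) = y) ∧
      (∀ᶠ z in 𝓝 x, l (A z) = z) := by
  haveI : CompleteSpace E := FiniteDimensional.complete ℝ E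
  obtain ⟨e, he⟩ := exists_equiv_of_inj _ hinj
  have hd : HasFDerivAt A (e : E →L[ℝ] E) x := by
    rw [he]; exact (hA.differentiable (by simp) x).hasFDerivAt
  have hs := (hA.contDiffAt (x := x)).hasStrictFDerivAt' hd (by simp)
  exact ⟨(hA.contDiffAt (x := x)).localInverse hd (by simp),
    (hA.contDiffAt (x := x)).to_localInverse hd (by simp),
    hs.localInverse_apply_image, hs.eventually_right_inverse, hs.eventually_left_inverse⟩

lemma inv_smooth (A G : E → E) (hA : ContDiff ℝ ∞ A)
    (hinj : ∀ x, Function.Injective (fderiv ℝ A x))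
    (hGA : ∀ x, G (A x) = x) (hAG : ∀ y, A (G y) = y) : ContDiff ℝ ∞ G := by
  rw [contDiff_iff_contDiffAt]
  intro y
  obtain ⟨l, h1, h2, h3, h4⟩ := local_inv A hA (G y) (hinj _)
  rw [hAG] at h1 h3
  refine h1.congr_of_eventuallyEq ?_
  filter_upwards [h3] with z hz
  rw [← hGA (l z), hz]

lemma compact_local_inv (m : E → E) (hm : ContDiff ℝ ∞ m) (N : Set E) (hN : IsCompact N)
    (hi : Set.InjOn m N) (hd : ∀ z ∈ N, Function.Injective (fderiv ℝ m z)) :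
    ∃ (Ω O : Set E) (τ : E → E), IsOpen Ω ∧ IsOpen O ∧ N ⊆ Ω ∧
      (∀ z ∈ Ω, m z ∈ O ∧ τ (m z) = z ∧ Function.Injective (fderiv ℝ m z)) ∧
      (∀ q ∈ O, τ q ∈ Ω ∧ m (τ q) = q ∧ ContDiffAt ℝ ∞ τ q) := by
  classical
  haveI : CompleteSpace E := FiniteDimensional.complete ℝ E
  obtain ⟨t, ht, htinj⟩ := hi.exists_mem_nhdsSet hN (fun x _ => hm.continuous.continuousAt) (by
    intro x hx
    obtain ⟨l, _, _, _, h4⟩ := local_inv m hm x (hd x hx)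
    refine ⟨_, h4, ?_⟩
    intro u hu v hv huv
    have hu' : l (m u) = u := hu
    have hv' : l (m v) = v := hv
    rw [← hu', ← hv', huv])
  obtain ⟨t', ht'o, hNt', ht't⟩ := mem_nhdsSet_iff_exists.1 ht
  let D : Set E := (fderiv ℝ m) ⁻¹' (Set.range ((↑) : (E ≃L[ℝ] E) → (E →L[ℝ] E)))
  have hDo : IsOpen D := ContinuousLinearEquiv.isOpen.preimage (hm.continuous_fderiv (by simp))
  have hDinj : ∀ z ∈ D, Function.Injective (fderiv ℝ m z) := by
    rintro z ⟨e, he⟩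
    rw [← he]; exact e.injective
  let Ω := t' ∩ D
  have hΩ : IsOpen Ω := ht'o.inter hDo
  have hinjΩ : Set.InjOn m Ω := htinj.mono (fun z hz => ht't hz.1)
  by_cases hne : Nonempty E
  swap
  · exact absurd ⟨(0 : E)⟩ hne
  have hτ : ∀ z ∈ Ω, Function.invFunOn m Ω (m z) = z := fun z hz =>
    hinjΩ (Function.invFunOn_mem ⟨z, hz, rfl⟩) hz (Function.invFunOn_eq ⟨z, hz, rfl⟩)
  refine ⟨Ω, m '' Ω, Function.invFunOn m Ω, hΩ, ?_, ?_, ?_, ?_⟩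
  · rw [isOpen_iff_mem_nhds]
    rintro _ ⟨z, hz, rfl⟩
    obtain ⟨l, h1, h2, h3, h4⟩ := local_inv m hm z (hDinj z hz.2)
    have : ∀ᶠ y in 𝓝 (m z), l y ∈ Ω := by
      apply h1.continuousAt.eventually_mem
      rw [h2]; exact hΩ.mem_nhds hz
    filter_upwards [this, h3] with y hy1 hy2
    exact ⟨l y, hy1, hy2⟩
  · intro z hz
    exact ⟨hNt' hz, by
      obtain ⟨e, he⟩ := exists_equiv_of_inj _ (hd z hz)
      exact ⟨e, he⟩⟩
  · intro z hz
    exact ⟨⟨z, hz, rfl⟩, hτ z hz, hDinj z hz.2⟩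
  · rintro _ ⟨z, hz, rfl⟩
    rw [hτ z hz]
    refine ⟨hz, rfl, ?_⟩
    obtain ⟨l, h1, h2, h3, h4⟩ := local_inv m hm z (hDinj z hz.2)
    refine h1.congr_of_eventuallyEq ?_
    have : ∀ᶠ y in 𝓝 (m z), l y ∈ Ω := by
      apply h1.continuousAt.eventually_mem
      rw [h2]; exact hΩ.mem_nhds hz
    filter_upwards [this, h3] with y hy1 hy2
    conv_lhs => rw [← hy2]
    exact hτ _ hy1

lemma near_id_fderiv_inj (k : E → E) (hk : ContDiff ℝ ∞ k) (C : NNReal) (hC : LipschitzWith C k)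
    (s : ℝ) (hs : |s| * C ≤ 1 / 2) (w v : E) (h : v + s • fderiv ℝ k w v = 0) : v = 0 := by
  have h1 : ‖fderiv ℝ k w v‖ ≤ C * ‖v‖ :=
    ((fderiv ℝ k w).le_opNorm v).trans
      (mul_le_mul_of_nonneg_right (norm_fderiv_le_of_lipschitz ℝ hC) (norm_nonneg _))
  have h2 : ‖v‖ = |s| * ‖fderiv ℝ k w v‖ := by
    rw [eq_neg_of_add_eq_zero_left h, norm_neg, norm_smul, Real.norm_eq_abs]
    congr 2
    rw [← eq_neg_of_add_eq_zero_left h]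
  have h3 : ‖v‖ ≤ (|s| * C) * ‖v‖ := by
    calc ‖v‖ = |s| * ‖fderiv ℝ k w v‖ := h2
      _ ≤ |s| * (C * ‖v‖) := mul_le_mul_of_nonneg_left h1 (abs_nonneg _)
      _ = _ := by ring
  have h4 : (|s| * C) * ‖v‖ ≤ 1 / 2 * ‖v‖ := mul_le_mul_of_nonneg_right hs (norm_nonneg _)
  have : ‖v‖ ≤ 0 := by linarith
  exact norm_le_zero_iff.1 this

lemma near_id (k : E → E) (hk : ContDiff ℝ ∞ k) (C : NNReal) (hC : LipschitzWith C k)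
    (s : ℝ → ℝ) (hs : ContDiff ℝ ∞ s) (hsC : ∀ t, |s t| * C ≤ 1 / 2) :
    ∃ G : ℝ × E → E, ContDiff ℝ ∞ G ∧ (∀ t w, G (t, w + s t • k w) = w) ∧
      (∀ t z, G (t, z) + s t • k (G (t, z)) = z) := by
  haveI : CompleteSpace E := FiniteDimensional.complete ℝ E
  have hsurj : ∀ t z, ∃ w, w + s t • k w = z := by
    intro t z
    have hc : ContractingWith (1 / 2) (fun w => z - s t • k w) := by
      refine ⟨by norm_num, ?_⟩
      apply LipschitzWith.of_dist_le_mul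
      intro x y
      rw [dist_eq_norm, dist_eq_norm]
      have h1 : ‖k x - k y‖ ≤ C * ‖x - y‖ := by
        rw [← dist_eq_norm, ← dist_eq_norm]; exact hC.dist_le_mul x y
      calc ‖z - s t • k x - (z - s t • k y)‖ = ‖s t • (k x - k y)‖ := by
            rw [← norm_neg]; congr 1; rw [smul_sub]; abel
        _ = |s t| * ‖k x - k y‖ := by rw [norm_smul, Real.norm_eq_abs]
        _ ≤ |s t| * (C * ‖x - y‖) := mul_le_mul_of_nonneg_left h1 (abs_nonneg _)
        _ = (|s t| * C) * ‖x - y‖ := by ring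
        _ ≤ _ := mul_le_mul_of_nonneg_right (by simpa using hsC t) (norm_nonneg _)
    refine ⟨hc.fixedPoint _, ?_⟩
    have := hc.fixedPoint_isFixedPt
    have h2 : z - s t • k (hc.fixedPoint _) = hc.fixedPoint _ := this
    nth_rewrite 1 [← h2]
    abel
  have hinj : ∀ t x y, x + s t • k x = y + s t • k y → x = y := by
    intro t x y h
    have h0 : x - y = - (s t • (k x - k y)) := by
      rw [smul_sub]
      have : x = y + s t • k y - s t • k x := by rw [← h]; abel
      nth_rewrite 1 [this]; abel
    have h1 : ‖k x - k y‖ ≤ C * ‖x - y‖ := by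
      rw [← dist_eq_norm, ← dist_eq_norm]; exact hC.dist_le_mul x y
    have h3 : ‖x - y‖ ≤ (|s t| * C) * ‖x - y‖ := by
      calc ‖x - y‖ = |s t| * ‖k x - k y‖ := by
            conv_lhs => rw [h0]
            rw [norm_neg, norm_smul, Real.norm_eq_abs]
        _ ≤ |s t| * (C * ‖x - y‖) := mul_le_mul_of_nonneg_left h1 (abs_nonneg _)
        _ = _ := by ring
    have h4 : (|s t| * C) * ‖x - y‖ ≤ 1 / 2 * ‖x - y‖ :=
      mul_le_mul_of_nonneg_right (hsC t) (norm_nonneg _)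
    have : ‖x - y‖ ≤ 0 := by linarith
    exact sub_eq_zero.1 (norm_le_zero_iff.1 this)
  choose G hG using hsurj
  have hG2 : ∀ t w, G t (w + s t • k w) = w := fun t w => hinj t _ _ (hG t _)
  refine ⟨fun p => G p.1 p.2, ?_, hG2, hG⟩
  let A : ℝ × E → ℝ × E := fun p => (p.1, p.2 + s p.1 • k p.2)
  have hA : ContDiff ℝ ∞ A :=
    contDiff_fst.prodMk (contDiff_snd.add ((hs.comp contDiff_fst).smul (hk.comp contDiff_snd)))
  have key : ContDiff ℝ ∞ (fun p : ℝ × E => ((p.1, G p.1 p.2) : ℝ × E)) := by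
    refine inv_smooth A _ hA ?_ ?_ ?_
    · rintro ⟨t, w⟩
      rw [injective_iff_map_eq_zero]
      rintro ⟨r, v⟩ h
      have hd : HasFDerivAt A ((ContinuousLinearMap.fst ℝ ℝ E).prod
          (ContinuousLinearMap.snd ℝ ℝ E +
            (s t • ((fderiv ℝ k w).comp (ContinuousLinearMap.snd ℝ ℝ E)) +
              ((fderiv ℝ s t).comp (ContinuousLinearMap.fst ℝ ℝ E)).smulRight (k w)))) (t, w) := by
        have e1 : HasFDerivAt (fun p : ℝ × E => s p.1)
            ((fderiv ℝ s t).comp (ContinuousLinearMap.fst ℝ ℝ E)) (t, w) :=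
          HasFDerivAt.comp (t, w) (f := Prod.fst) (hs.differentiable (by simp) t).hasFDerivAt
            hasFDerivAt_fst
        have e2 : HasFDerivAt (fun p : ℝ × E => k p.2)
            ((fderiv ℝ k w).comp (ContinuousLinearMap.snd ℝ ℝ E)) (t, w) :=
          HasFDerivAt.comp (t, w) (f := Prod.snd) (hk.differentiable (by simp) w).hasFDerivAt
            hasFDerivAt_snd
        exact hasFDerivAt_fst.prodMk (hasFDerivAt_snd.add (e1.smul e2))
      rw [hd.fderiv] at h
      simp only [ContinuousLinearMap.prod_apply, ContinuousLinearMap.coe_fst',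
        ContinuousLinearMap.add_apply, ContinuousLinearMap.coe_snd',
        ContinuousLinearMap.smul_apply, ContinuousLinearMap.comp_apply,
        ContinuousLinearMap.smulRight_apply, Prod.mk_eq_zero] at h
      obtain ⟨hr, hv⟩ := h
      subst hr
      simp only [map_zero, zero_smul, add_zero] at hv
      rw [near_id_fderiv_inj k hk C hC (s t) (hsC t) w v hv]
      rfl
    · rintro ⟨t, w⟩
      simp [A, hG2]
    · rintro ⟨t, w⟩
      simp [A, hG]
  exact contDiff_snd.comp key

end general

lemma lin4 (T : R4 →L[ℝ] ℝ) (u : R4) :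
    T u = u.1 * T (1, 0, 0, 0) + u.2.1 * T (0, 1, 0, 0) + u.2.2.1 * T (0, 0, 1, 0)
      + u.2.2.2 * T (0, 0, 0, 1) := by
  have : u = u.1 • ((1, 0, 0, 0) : R4) + u.2.1 • ((0, 1, 0, 0) : R4)
      + u.2.2.1 • ((0, 0, 1, 0) : R4) + u.2.2.2 • ((0, 0, 0, 1) : R4) := by
    ext <;> simp
  conv_lhs => rw [this]
  simp only [map_add, map_smul, smul_eq_mul]

lemma omega4_nondeg (u : R4) (h : ∀ v, omega4 u v = 0) : u = 0 := by
  have h1 := h (1, 0, 0, 0)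
  have h2 := h (0, 1, 0, 0)
  have h3 := h (0, 0, 1, 0)
  have h4 := h (0, 0, 0, 1)
  simp [omega4] at h1 h2 h3 h4
  ext <;> simp [*]

structure Iso (a ε : ℝ) (Φ : ℝ × R4 → R4) : Prop where
  smooth : ContDiff ℝ ∞ Φ
  zero : ∀ p, Φ (0, p) = p
  bij : ∀ t, Function.Bijective (fun p => Φ (t, p))
  symp : ∀ t p u v, omega4 (fderiv ℝ (fun p => Φ (t, p)) p u)
    (fderiv ℝ (fun p => Φ (t, p)) p v) = omega4 u v
  fixA : ∀ t (p : R4), p.2.2.2 = a → Φ (t, p) = p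
  fixOut : ∀ t (p : R4), ε ≤ |p.2.2.2 - a| → Φ (t, p) = p

lemma Iso.smooth_t {a ε : ℝ} {Φ : ℝ × R4 → R4} (h : Iso a ε Φ) (t : ℝ) :
    ContDiff ℝ ∞ (fun p => Φ (t, p)) :=
  h.smooth.comp (contDiff_const.prodMk contDiff_id)

lemma Iso.isSymp {a ε : ℝ} {Φ : ℝ × R4 → R4} (h : Iso a ε Φ) (t : ℝ) :
    IsSymplectomorphism (fun p => Φ (t, p)) := by
  refine ⟨h.bij t, h.smooth_t t, ?_, h.symp t⟩
  refine inv_smooth (fun p => Φ (t, p)) _ (h.smooth_t t) ?_ ?_ ?_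
  · intro x
    rw [injective_iff_map_eq_zero]
    intro u hu
    apply omega4_nondeg
    intro v
    rw [← h.symp t x, hu]
    simp [omega4]
  · exact Function.leftInverse_invFun (h.bij t).1
  · exact Function.rightInverse_invFun (h.bij t).2

lemma Iso.id (a ε : ℝ) : Iso a ε (fun p => p.2) where
  smooth := contDiff_snd
  zero := fun _ => rfl
  bij := fun _ => Function.bijective_id
  symp := by
    intro t p u v
    have : fderiv ℝ (fun p : R4 => p) p = ContinuousLinearMap.id ℝ R4 := fderiv_fun_id
    simp only [this]
    rfl
  fixA := fun _ _ _ => rfl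
  fixOut := fun _ _ _ => rfl

lemma Iso.comp {a ε : ℝ} {Φ Ψ : ℝ × R4 → R4} (h : Iso a ε Ψ) (h' : Iso a ε Φ) :
    Iso a ε (fun p => Ψ (p.1, Φ p)) where
  smooth := h.smooth.comp (contDiff_fst.prodMk h'.smooth)
  zero := fun p => by simp [h.zero, h'.zero]
  bij := fun t => (h.bij t).comp (h'.bij t)
  symp := by
    intro t p u v
    have e : fderiv ℝ (fun p => Ψ (t, Φ (t, p))) p =
        (fderiv ℝ (fun p => Ψ (t, p)) (Φ (t, p))).comp (fderiv ℝ (fun p => Φ (t, p)) p) :=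
      fderiv_comp p (g := fun p => Ψ (t, p)) (f := fun p => Φ (t, p))
        ((h.smooth_t t).differentiable (by simp) _) ((h'.smooth_t t).differentiable (by simp) _)
    simp only [e, ContinuousLinearMap.comp_apply]
    rw [h.symp, h'.symp]
  fixA := fun t p hp => by
    simp only [h'.fixA t p hp, h.fixA t p hp]
  fixOut := fun t p hp => by
    simp only [h'.fixOut t p hp, h.fixOut t p hp]

lemma gen_step (a ε : ℝ) (H : R4 → ℝ) (hH : ContDiff ℝ ∞ H) (hc : HasCompactSupport H)
    (h0 : ∀ w : R4, w.2.2.2 = a ∨ ε ≤ |w.2.2.2 - a| → fderiv ℝ H w = 0) :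
    ∃ (n : ℕ) (_ : 0 < n) (Ψ : ℝ × R4 → R4), Iso a ε Ψ ∧
      ∀ q : R4, q.2.2.2 = a → ∀ α β : R2 → ℝ,
      (∀ᶠ w in 𝓝 q, fderiv ℝ H w (1, 0, 0, 0) = α (w.1, w.2.2.2) ∧
        fderiv ℝ H w (0, 1, 0, 0) = 0 ∧ fderiv ℝ H w (0, 0, 1, 0) = 0 ∧
        fderiv ℝ H w (0, 0, 0, 1) = β (w.1, w.2.2.2)) →
      ∀ᶠ z in 𝓝 q, Ψ (1, z) = z + (1 / (n : ℝ)) •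
        ((0, β (z.1, z.2.2.2), - α (z.1, z.2.2.2), 0) : R4) := by
  have hdH : ContDiff ℝ ∞ (fderiv ℝ H) := hH.fderiv_right (by simp)
  have hde : ∀ e : R4, ContDiff ℝ ∞ (fun w => fderiv ℝ H w e) := fun e =>
    hdH.clm_apply contDiff_const
  let kA : R4 → R4 := fun w => (0, - fderiv ℝ H w (0, 0, 0, 1), fderiv ℝ H w (1, 0, 0, 0), 0)
  let kB : R4 → R4 := fun w => (fderiv ℝ H w (0, 0, 1, 0), 0, 0, - fderiv ℝ H w (0, 1, 0, 0))
  have hkA : ContDiff ℝ ∞ kA :=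
    contDiff_const.prodMk ((hde _).neg.prodMk ((hde _).prodMk contDiff_const))
  have hkB : ContDiff ℝ ∞ kB :=
    (hde _).prodMk (contDiff_const.prodMk (contDiff_const.prodMk (hde _).neg))
  have kA0 : ∀ w, fderiv ℝ H w = 0 → kA w = 0 := by
    intro w hw; simp [kA, hw]
  have kB0 : ∀ w, fderiv ℝ H w = 0 → kB w = 0 := by
    intro w hw; simp [kB, hw]
  have hcd : HasCompactSupport (fderiv ℝ H) := hc.fderiv ℝ
  have hcA : HasCompactSupport kA := by
    refine hcd.mono ?_
    intro w hw h; exact hw (kA0 w h)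
  have hcB : HasCompactSupport kB := by
    refine hcd.mono ?_
    intro w hw h; exact hw (kB0 w h)
  obtain ⟨CA, hCA⟩ := hkA.lipschitzWith_of_hasCompactSupport hcA (by simp)
  obtain ⟨CB, hCB⟩ := hkB.lipschitzWith_of_hasCompactSupport hcB (by simp)
  obtain ⟨n, hn⟩ := exists_nat_gt (2 * max (CA : ℝ) (CB : ℝ))
  have hn0 : (0 : ℝ) < n := by
    refine lt_of_le_of_lt ?_ hn
    have : (0 : ℝ) ≤ CA := CA.2
    have := le_max_left (CA : ℝ) CB
    linarith
  let s : ℝ → ℝ := fun t => Real.smoothTransition t / n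
  have hs : ContDiff ℝ ∞ s := Real.smoothTransition.contDiff.div_const _
  have hs0 : s 0 = 0 := by simp [s]
  have hs1 : s 1 = 1 / n := by simp [s]
  have hsC : ∀ C : NNReal, (C : ℝ) ≤ max (CA : ℝ) CB → ∀ t, |s t| * C ≤ 1 / 2 := by
    intro C hC t
    have h1 : |s t| ≤ 1 / n := by
      rw [abs_of_nonneg (div_nonneg (Real.smoothTransition.nonneg t) hn0.le)]
      exact div_le_div_of_nonneg_right (Real.smoothTransition.le_one t) hn0.le
    calc |s t| * C ≤ 1 / n * C := mul_le_mul_of_nonneg_right h1 C.2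
      _ = C / n := by ring
      _ ≤ 1 / 2 := by
        rw [div_le_div_iff₀ hn0 (by norm_num)]
        linarith
  obtain ⟨GA, hGA, hGA1, hGA2⟩ := near_id kA hkA CA hCA s hs (hsC CA (le_max_left _ _))
  obtain ⟨GB, hGB, hGB1, hGB2⟩ := near_id kB hkB CB hCB s hs (hsC CB (le_max_right _ _))
  have hfix : ∀ t w, fderiv ℝ H w = 0 → GA (t, w) + s t • kB (GA (t, w)) = w := by
    intro t w hw
    have : GA (t, w) = w := by
      have := hGA1 t w
      rwa [kA0 w hw, smul_zero, add_zero] at this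
    rw [this, kB0 w hw, smul_zero, add_zero]
  refine ⟨n, by exact_mod_cast hn0, fun p => GA p + s p.1 • kB (GA p), ?_, ?_⟩
  · refine ⟨hGA.add ((hs.comp contDiff_fst).smul (hkB.comp hGA)), ?_, ?_, ?_, ?_, ?_⟩
    · intro p
      have := hGA2 0 p
      simp only [hs0, zero_smul, add_zero] at this ⊢
      exact this
    · intro t
      constructor
      · intro x y hxy
        have h1 := congrArg (fun z => GB (t, z)) hxy
        simp only [hGB1] at h1
        have h2 := hGA2 t x
        rw [h1, hGA2] at h2
        exact h2.symm
      · intro y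
        refine ⟨GB (t, y) + s t • kA (GB (t, y)), ?_⟩
        simp only [hGA1, hGB2]
    · intro t p u v
      set w := GA (t, p) with hw
      have hp : p = w + s t • kA w := (hGA2 t p).symm
      set φ : R4 → R4 := fun p => GA (t, p) + s t • kB (GA (t, p)) with hφ
      have hφs : ContDiff ℝ ∞ φ := by
        have h1 : ContDiff ℝ ∞ (fun p => GA (t, p)) :=
          hGA.comp (contDiff_const.prodMk contDiff_id)
        exact h1.add ((hkB.comp h1).const_smul _)
      set D2 := fderiv ℝ (fderiv ℝ H) w with hD2
      have hsymm : ∀ u v, D2 u v = D2 v u := fun u v =>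
        (hH.contDiffAt (x := w)).isSymmSndFDerivAt (by
          rw [minSmoothness_of_isRCLikeNormedField]; exact ENat.LEInfty.out) u v
      have hdd : ∀ e : R4, HasFDerivAt (fun w => fderiv ℝ H w e) (D2.flip e) w := by
        intro e
        have := ((hdH.differentiable (by simp) w).hasFDerivAt).clm_apply
          (hasFDerivAt_const e w)
        rw [ContinuousLinearMap.comp_zero, zero_add] at this
        exact this
      have hdA : HasFDerivAt (fun w => w + s t • kA w) (ContinuousLinearMap.id ℝ R4 + s t •
          ((0 : R4 →L[ℝ] ℝ).prod ((-(D2.flip (0, 0, 0, 1))).prod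
            ((D2.flip (1, 0, 0, 0)).prod 0)))) w :=
        (hasFDerivAt_id w).add (((hasFDerivAt_const (0 : ℝ) w).prodMk ((hdd _).neg.prodMk
          ((hdd _).prodMk (hasFDerivAt_const (0 : ℝ) w)))).const_smul (s t))
      have hdB : HasFDerivAt (fun w => w + s t • kB w) (ContinuousLinearMap.id ℝ R4 + s t •
          ((D2.flip (0, 0, 1, 0)).prod ((0 : R4 →L[ℝ] ℝ).prod
            ((0 : R4 →L[ℝ] ℝ).prod (-(D2.flip (0, 1, 0, 0))))))) w :=
        (hasFDerivAt_id w).add (((hdd _).prodMk ((hasFDerivAt_const (0 : ℝ) w).prodMk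
          ((hasFDerivAt_const (0 : ℝ) w).prodMk (hdd _).neg))).const_smul (s t))
      set TA := ContinuousLinearMap.id ℝ R4 + s t •
          ((0 : R4 →L[ℝ] ℝ).prod ((-(D2.flip (0, 0, 0, 1))).prod
            ((D2.flip (1, 0, 0, 0)).prod 0))) with hTA
      set TB := ContinuousLinearMap.id ℝ R4 + s t •
          ((D2.flip (0, 0, 1, 0)).prod ((0 : R4 →L[ℝ] ℝ).prod
            ((0 : R4 →L[ℝ] ℝ).prod (-(D2.flip (0, 1, 0, 0)))))) with hTB
      have hcomp : (fderiv ℝ φ p).comp TA = TB := by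
        have h1 : HasFDerivAt φ (fderiv ℝ φ p) (w + s t • kA w) := by
          rw [← hp]; exact (hφs.differentiable (by simp) p).hasFDerivAt
        have h2 := h1.comp w hdA
        have h3 : (φ ∘ fun w => w + s t • kA w) = fun w => w + s t • kB w := by
          funext w
          simp only [hφ, Function.comp, hGA1]
        rw [h3] at h2
        exact h2.unique hdB
      have hTAinj : Function.Injective TA := by
        rw [injective_iff_map_eq_zero]
        intro v hv
        refine near_id_fderiv_inj kA hkA CA hCA (s t) (hsC CA (le_max_left _ _) t) w v ?_
        have e1 : fderiv ℝ kA w = ((0 : R4 →L[ℝ] ℝ).prod ((-(D2.flip (0, 0, 0, 1))).prod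
            ((D2.flip (1, 0, 0, 0)).prod 0))) :=
          ((hasFDerivAt_const (0 : ℝ) w).prodMk ((hdd _).neg.prodMk
          ((hdd _).prodMk (hasFDerivAt_const (0 : ℝ) w)))).fderiv
        rw [e1]
        exact hv
      obtain ⟨e, he⟩ := exists_equiv_of_inj TA hTAinj
      obtain ⟨u', hu⟩ := e.surjective u
      obtain ⟨v', hv⟩ := e.surjective v
      have hu : TA u' = u := by rw [← he]; exact hu
      have hv : TA v' = v := by rw [← he]; exact hv
      have hBu : fderiv ℝ φ p u = TB u' := by rw [← hu, ← hcomp]; rfl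
      have hBv : fderiv ℝ φ p v = TB v' := by rw [← hv, ← hcomp]; rfl
      rw [hBu, hBv, ← hu, ← hv]
      have key := hsymm u' v'
      rw [lin4 (D2 u') v', lin4 (D2 v') u'] at key
      have eA : ∀ x : R4, TA x = (x.1, x.2.1 - s t * D2 x (0, 0, 0, 1),
          x.2.2.1 + s t * D2 x (1, 0, 0, 0), x.2.2.2) := by
        intro x
        ext <;> simp [hTA] <;> ring
      have eB : ∀ x : R4, TB x = (x.1 + s t * D2 x (0, 0, 1, 0), x.2.1,
          x.2.2.1, x.2.2.2 - s t * D2 x (0, 1, 0, 0)) := by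
        intro x
        ext <;> simp [hTB] <;> ring
      rw [eA, eA, eB, eB]
      simp only [omega4]
      linear_combination (s t) * key
    · intro t p hp
      exact hfix t p (h0 p (Or.inl hp))
    · intro t p hp
      exact hfix t p (h0 p (Or.inr hp))
  · intro q hq α β hloc
    have hdq := h0 q (Or.inl hq)
    have hz := hloc.self_of_nhds
    rw [hdq] at hz
    have hα : α (q.1, q.2.2.2) = 0 := hz.1.symm
    have hβ : β (q.1, q.2.2.2) = 0 := hz.2.2.2.symm
    -- z' = z + ...
    let ζ : R4 → R4 := fun z => z + (1 / (n : ℝ)) •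
        ((0, fderiv ℝ H z (0, 0, 0, 1), - fderiv ℝ H z (1, 0, 0, 0), 0) : R4)
    have hζc : Continuous ζ := by
      have h1 := (hde (0, 0, 0, 1)).continuous
      have h2 := (hde (1, 0, 0, 0)).continuous
      fun_prop
    have hζq : ζ q = q := by
      simp [ζ, hdq]
    have hζt : Tendsto ζ (𝓝 q) (𝓝 q) := by
      have := hζc.tendsto q
      rwa [hζq] at this
    filter_upwards [hloc, hζt.eventually hloc] with z h1 h2
    have hζz : ζ z = z + (1 / (n : ℝ)) • ((0, β (z.1, z.2.2.2), - α (z.1, z.2.2.2), 0) : R4) := by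
      simp only [ζ, h1.1, h1.2.2.2]
    have hπ : ((ζ z).1, (ζ z).2.2.2) = (z.1, z.2.2.2) := by simp [ζ]
    rw [hπ] at h2
    have hA : ζ z + s 1 • kA (ζ z) = z := by
      simp only [kA, h2.1, h2.2.2.2, hs1]
      rw [hζz]
      ext <;> simp
    have hG : GA (1, z) = ζ z := by
      have := hGA1 1 (ζ z)
      rwa [hA] at this
    have hB : kB (ζ z) = 0 := by simp [kB, h2.2.1, h2.2.2.1]
    simp only [hG, hB, smul_zero, add_zero]
    exact hζz

lemma gen_fun (a ε : ℝ) (H : R4 → ℝ) (hH : ContDiff ℝ ∞ H) (hc : HasCompactSupport H)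
    (h0 : ∀ w : R4, w.2.2.2 = a ∨ ε ≤ |w.2.2.2 - a| → fderiv ℝ H w = 0) :
    ∃ (Ψ : ℝ × R4 → R4), Iso a ε Ψ ∧
      ∀ q : R4, q.2.2.2 = a → ∀ α β : R2 → ℝ,
      (∀ᶠ w in 𝓝 q, fderiv ℝ H w (1, 0, 0, 0) = α (w.1, w.2.2.2) ∧
        fderiv ℝ H w (0, 1, 0, 0) = 0 ∧ fderiv ℝ H w (0, 0, 1, 0) = 0 ∧
        fderiv ℝ H w (0, 0, 0, 1) = β (w.1, w.2.2.2)) →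
      ∀ᶠ z in 𝓝 q, Ψ (1, z) = z + ((0, β (z.1, z.2.2.2), - α (z.1, z.2.2.2), 0) : R4) := by
  obtain ⟨n, hn, ψ, hψ, hloc⟩ := gen_step a ε H hH hc h0
  have hn' : (n : ℝ) ≠ 0 := by positivity
  have key : ∀ k : ℕ, ∃ (Ψ : ℝ × R4 → R4), Iso a ε Ψ ∧
      ∀ q : R4, q.2.2.2 = a → ∀ α β : R2 → ℝ,
      (∀ᶠ w in 𝓝 q, fderiv ℝ H w (1, 0, 0, 0) = α (w.1, w.2.2.2) ∧
        fderiv ℝ H w (0, 1, 0, 0) = 0 ∧ fderiv ℝ H w (0, 0, 1, 0) = 0 ∧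
        fderiv ℝ H w (0, 0, 0, 1) = β (w.1, w.2.2.2)) →
      ∀ᶠ z in 𝓝 q, Ψ (1, z) = z + ((k : ℝ) / n) •
        ((0, β (z.1, z.2.2.2), - α (z.1, z.2.2.2), 0) : R4) := by
    intro k
    induction k with
    | zero => exact ⟨_, Iso.id a ε, fun q _ α β _ => by simp⟩
    | succ k ih =>
      obtain ⟨Ψ, hΨ, hk⟩ := ih
      refine ⟨_, hψ.comp hΨ, ?_⟩
      intro q hq α β h
      have h1 := hloc q hq α β h
      have h2 := hk q hq α β h
      have ht : Tendsto (fun z => Ψ (1, z)) (𝓝 q) (𝓝 q) := by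
        have := (hΨ.smooth_t 1).continuous.tendsto q
        rwa [hΨ.fixA 1 q hq] at this
      filter_upwards [h2, ht.eventually h1] with z hz1 hz2
      rw [hz2, hz1]
      ext <;> simp <;> ring
  obtain ⟨Ψ, h1, h2⟩ := key n
  refine ⟨Ψ, h1, ?_⟩
  intro q hq α β h
  have := h2 q hq α β h
  filter_upwards [this] with z hz
  rwa [div_self hn', one_smul] at hz

lemma bump_iso (a ε : ℝ) (hε : 0 < ε) (c : R4) (r δ : ℝ) (hr : 0 < r) (hδ : 0 < δ)
    (F : R2 → ℝ)
    (hF : ∀ q : R2, |q.1 - c.1| < 2 * r → |q.2 - a| < δ → ContDiffAt ℝ ∞ F q)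
    (hF0 : ∀ b, |b - c.1| < 2 * r → F (b, a) = 0)
    (hF1 : ∀ b, |b - c.1| < 2 * r → fderiv ℝ F (b, a) = 0) :
    ∃ Ψ, Iso a ε Ψ ∧
      (∀ q : R4, q.2.2.2 = a → q ∉ Metric.closedBall c r → ∀ᶠ z in 𝓝 q, Ψ (1, z) = z) ∧
      (∀ q : R4, q.2.2.2 = a → |q.1 - c.1| < 2 * r → (∀ᶠ x in 𝓝 ((q.1, a) : R2), F x = 0) →
        ∀ᶠ z in 𝓝 q, Ψ (1, z) = z) ∧
      (∀ q : R4, q.2.2.2 = a → q ∈ Metric.ball c (r / 2) → ∀ᶠ z in 𝓝 q, Ψ (1, z) =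
        z + ((0, fderiv ℝ F (z.1, z.2.2.2) (0, 1), - fderiv ℝ F (z.1, z.2.2.2) (1, 0), 0) : R4)) := by
  let π : R4 →L[ℝ] R2 := (ContinuousLinearMap.fst ℝ ℝ (ℝ × ℝ × ℝ)).prod
    ((ContinuousLinearMap.snd ℝ ℝ ℝ).comp ((ContinuousLinearMap.snd ℝ ℝ (ℝ × ℝ)).comp
      (ContinuousLinearMap.snd ℝ ℝ (ℝ × ℝ × ℝ))))
  have hπ : ∀ w : R4, π w = (w.1, w.2.2.2) := fun w => rfl
  let ρ : ContDiffBump c := ⟨r / 2, r, by linarith, by linarith⟩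
  have hδε : 0 < min δ ε := lt_min hδ hε
  let β : ContDiffBump a := ⟨min δ ε / 4, min δ ε / 2, by linarith, by linarith⟩
  let k : R4 → ℝ := fun w => ρ w * β w.2.2.2
  have h4c : ContDiff ℝ ∞ (fun w : R4 => w.2.2.2) :=
    contDiff_snd.comp (contDiff_snd.comp contDiff_snd)
  have hk : ContDiff ℝ ∞ k := ρ.contDiff.mul (β.contDiff.comp h4c)
  let H : R4 → ℝ := fun w => F (π w) * k w
  -- vanishing of k
  have hkρ : ∀ w, w ∉ Metric.closedBall c r → ∀ᶠ z in 𝓝 w, k z = 0 := by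
    intro w hw
    filter_upwards [Metric.isClosed_closedBall.isOpen_compl.mem_nhds hw] with z hz
    have : ρ z = 0 := ρ.zero_of_le_dist (by
      simp only [Set.mem_compl_iff, Metric.mem_closedBall, not_le] at hz
      exact hz.le)
    simp [k, this]
  have hkβ : ∀ w : R4, min δ ε ≤ |w.2.2.2 - a| → ∀ᶠ z in 𝓝 w, k z = 0 := by
    intro w hw
    have : ∀ᶠ z : R4 in 𝓝 w, min δ ε / 2 < |z.2.2.2 - a| := by
      have hc : Continuous (fun z : R4 => |z.2.2.2 - a|) := by fun_prop
      exact hc.continuousAt.eventually_const_lt (by simp only; linarith)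
    filter_upwards [this] with z hz
    have : β z.2.2.2 = 0 := β.zero_of_le_dist (by rw [Real.dist_eq]; exact hz.le)
    simp [k, this]
  have hH0 : ∀ w, (∀ᶠ z in 𝓝 w, k z = 0) → H =ᶠ[𝓝 w] fun _ => 0 := by
    intro w hw
    filter_upwards [hw] with z hz
    simp [H, hz]
  have hdH0 : ∀ w, (∀ᶠ z in 𝓝 w, k z = 0) → fderiv ℝ H w = 0 := by
    intro w hw
    rw [(hH0 w hw).fderiv_eq]; simp
  have hcase : ∀ w : R4, (|w.1 - c.1| < 2 * r ∧ |w.2.2.2 - a| < δ) ∨ (∀ᶠ z in 𝓝 w, k z = 0) := by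
    intro w
    by_cases h1 : |w.1 - c.1| < 2 * r
    · by_cases h2 : |w.2.2.2 - a| < δ
      · exact Or.inl ⟨h1, h2⟩
      · exact Or.inr (hkβ w ((min_le_left _ _).trans (not_lt.1 h2)))
    · refine Or.inr (hkρ w ?_)
      intro h
      rw [Metric.mem_closedBall, Prod.dist_eq] at h
      have := (le_max_left _ _).trans h
      rw [Real.dist_eq] at this
      linarith
  have hHs : ContDiff ℝ ∞ H := by
    rw [contDiff_iff_contDiffAt]
    intro w
    rcases hcase w with ⟨h1, h2⟩ | h
    · exact ((hF (π w) h1 h2).comp w π.contDiff.contDiffAt).mul hk.contDiffAt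
    · exact contDiffAt_const.congr_of_eventuallyEq (hH0 w h)
  have hHc : HasCompactSupport H := by
    refine ρ.hasCompactSupport.mono ?_
    intro w hw h
    apply hw
    simp [H, k, h]
  have hd0 : ∀ w : R4, w.2.2.2 = a ∨ ε ≤ |w.2.2.2 - a| → fderiv ℝ H w = 0 := by
    rintro w (hw | hw)
    · rcases hcase w with ⟨h1, h2⟩ | h
      · have hπw : π w = (w.1, a) := by rw [hπ, hw]
        have e1 : HasFDerivAt (fun w => F (π w)) ((0 : R2 →L[ℝ] ℝ).comp π) w := by
          refine HasFDerivAt.comp w ?_ π.hasFDerivAt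
          rw [hπw, ← hF1 w.1 h1]
          exact ((hF (w.1, a) h1 (by simpa using hδ)).differentiableAt (by simp)).hasFDerivAt
        have e2 := e1.mul (hk.differentiable (by simp) w).hasFDerivAt
        have e3 : fderiv ℝ H w = _ := e2.fderiv
        rw [e3, hπw, hF0 w.1 h1]
        simp
      · exact hdH0 w h
    · exact hdH0 w (hkβ w ((min_le_right _ _).trans hw))
  obtain ⟨Ψ, hΨ, hloc⟩ := gen_fun a ε H hHs hHc hd0
  have hzero : ∀ q : R4, q.2.2.2 = a → (∀ᶠ z in 𝓝 q, H z = 0) → ∀ᶠ z in 𝓝 q, Ψ (1, z) = z := by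
    intro q hq h
    have h' : ∀ᶠ z in 𝓝 q, fderiv ℝ H z = 0 := by
      filter_upwards [h.eventually_nhds] with z hz
      have : H =ᶠ[𝓝 z] fun _ => 0 := hz
      rw [this.fderiv_eq]; simp
    have := hloc q hq (fun _ => 0) (fun _ => 0) (by
      filter_upwards [h'] with z hz
      simp [hz])
    filter_upwards [this] with z hz
    rw [hz]
    ext <;> simp
  refine ⟨Ψ, hΨ, ?_, ?_, ?_⟩
  · intro q hq hqc
    exact hzero q hq (hH0 q (hkρ q hqc))
  · intro q hq h1 h2
    apply hzero q hq
    have : Tendsto π (𝓝 q) (𝓝 (q.1, a)) := by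
      have := π.continuous.tendsto q
      rwa [hπ, hq] at this
    filter_upwards [this.eventually h2] with z hz
    simp [H, hz]
  · intro q hq hqb
    have h1 : |q.1 - c.1| < 2 * r := by
      rw [Metric.mem_ball, Prod.dist_eq] at hqb
      have := (le_max_left _ _).trans_lt hqb
      rw [Real.dist_eq] at this
      linarith
    have hk1 : ∀ᶠ z in 𝓝 q, k z = 1 := by
      have hb : ∀ᶠ z : R4 in 𝓝 q, |z.2.2.2 - a| < min δ ε / 4 := by
        have hc : Continuous (fun z : R4 => |z.2.2.2 - a|) := by fun_prop
        refine hc.continuousAt.eventually_lt_const ?_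
        simp only [hq]; simpa using hδε
      filter_upwards [hb, Metric.isOpen_ball.mem_nhds hqb] with z hz hz2
      have e1 : ρ z = 1 := ρ.one_of_mem_closedBall (Metric.ball_subset_closedBall hz2)
      have e2 : β z.2.2.2 = 1 := β.one_of_mem_closedBall (by
        rw [Metric.mem_closedBall, Real.dist_eq]; exact hz.le)
      simp [k, e1, e2]
    have hQ : ∀ᶠ z : R4 in 𝓝 q, |z.1 - c.1| < 2 * r ∧ |z.2.2.2 - a| < δ := by
      refine Filter.Eventually.and ?_ ?_
      · have hc : Continuous (fun z : R4 => |z.1 - c.1|) := by fun_prop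
        exact hc.continuousAt.eventually_lt_const h1
      · have hc : Continuous (fun z : R4 => |z.2.2.2 - a|) := by fun_prop
        refine hc.continuousAt.eventually_lt_const ?_
        simp only [hq]; simpa using hδ
    have hHd : ∀ᶠ z in 𝓝 q, fderiv ℝ H z = (fderiv ℝ F (z.1, z.2.2.2)).comp π := by
      filter_upwards [hk1.eventually_nhds, hQ] with z hz hz2
      have e : H =ᶠ[𝓝 z] fun w => F (π w) := by
        filter_upwards [hz] with y hy
        simp [H, hy]
      rw [e.fderiv_eq]
      exact (HasFDerivAt.comp z ((hF (π z) hz2.1 hz2.2).differentiableAt (by simp)).hasFDerivAt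
        π.hasFDerivAt).fderiv
    refine hloc q hq (fun x => fderiv ℝ F x (1, 0)) (fun x => fderiv ℝ F x (0, 1)) ?_
    filter_upwards [hHd] with z hz
    rw [hz]
    refine ⟨rfl, ?_, ?_, rfl⟩
    · show fderiv ℝ F _ ((0, 0) : R2) = 0
      exact map_zero _
    · show fderiv ℝ F _ ((0, 0) : R2) = 0
      exact map_zero _

lemma comp_fderivs (u : R2 → R4) (q : R2) (hu : DifferentiableAt ℝ u q) :
    HasFDerivAt (fun q => (u q).1) ((ContinuousLinearMap.fst ℝ ℝ (ℝ × ℝ × ℝ)).comp (fderiv ℝ u q)) q ∧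
    HasFDerivAt (fun q => (u q).2.1) (((ContinuousLinearMap.fst ℝ ℝ (ℝ × ℝ)).comp
      (ContinuousLinearMap.snd ℝ ℝ (ℝ × ℝ × ℝ))).comp (fderiv ℝ u q)) q ∧
    HasFDerivAt (fun q => (u q).2.2.1) (((ContinuousLinearMap.fst ℝ ℝ ℝ).comp
      ((ContinuousLinearMap.snd ℝ ℝ (ℝ × ℝ)).comp
      (ContinuousLinearMap.snd ℝ ℝ (ℝ × ℝ × ℝ)))).comp (fderiv ℝ u q)) q ∧
    HasFDerivAt (fun q => (u q).2.2.2) (((ContinuousLinearMap.snd ℝ ℝ ℝ).comp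
      ((ContinuousLinearMap.snd ℝ ℝ (ℝ × ℝ)).comp
      (ContinuousLinearMap.snd ℝ ℝ (ℝ × ℝ × ℝ)))).comp (fderiv ℝ u q)) q := by
  have h := hu.hasFDerivAt
  exact ⟨h.fst, h.snd.fst, h.snd.snd.fst, h.snd.snd.snd⟩

lemma sec_closed (u : R2 → R4) (q : R2) (hu : DifferentiableAt ℝ u q)
    (hs : ∀ᶠ x in 𝓝 q, (u x).1 = x.1 ∧ (u x).2.2.2 = x.2)
    (hi : ∀ x y, omega4 (fderiv ℝ u q x) (fderiv ℝ u q y) = 0) (x y : R2) :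
    (fderiv ℝ u q x).2.2.1 * y.1 - (fderiv ℝ u q x).2.1 * y.2 =
    (fderiv ℝ u q y).2.2.1 * x.1 - (fderiv ℝ u q y).2.1 * x.2 := by
  obtain ⟨h1, -, -, h4⟩ := comp_fderivs u q hu
  have e1 : ∀ v, (fderiv ℝ u q v).1 = v.1 := by
    intro v
    have : (fun q => (u q).1) =ᶠ[𝓝 q] Prod.fst := hs.mono fun x hx => hx.1
    have h := (hasFDerivAt_fst (𝕜 := ℝ) (p := q)).congr_of_eventuallyEq this
    exact congrArg (fun T => T v) (h1.unique h)
  have e4 : ∀ v, (fderiv ℝ u q v).2.2.2 = v.2 := by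
    intro v
    have : (fun q => (u q).2.2.2) =ᶠ[𝓝 q] Prod.snd := hs.mono fun x hx => hx.2
    have h := (hasFDerivAt_snd (𝕜 := ℝ) (p := q)).congr_of_eventuallyEq this
    exact congrArg (fun T => T v) (h4.unique h)
  have := hi x y
  simp only [omega4, e1, e4] at this
  linarith

lemma primitive (Q : Set R2) (hQ : IsOpen Q) (hQc : Convex ℝ Q) (u u' : R2 → R4)
    (hu : ∀ q ∈ Q, ContDiffAt ℝ ∞ u q) (hu' : ∀ q ∈ Q, ContDiffAt ℝ ∞ u' q)
    (hs : ∀ q ∈ Q, (u q).1 = q.1 ∧ (u q).2.2.2 = q.2)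
    (hs' : ∀ q ∈ Q, (u' q).1 = q.1 ∧ (u' q).2.2.2 = q.2)
    (hi : ∀ q ∈ Q, ∀ x y, omega4 (fderiv ℝ u q x) (fderiv ℝ u q y) = 0)
    (hi' : ∀ q ∈ Q, ∀ x y, omega4 (fderiv ℝ u' q x) (fderiv ℝ u' q y) = 0) :
    ∃ F : R2 → ℝ, (∀ q ∈ Q, ContDiffAt ℝ ∞ F q) ∧
      ∀ q ∈ Q, fderiv ℝ F q = ((u q).2.2.1 - (u' q).2.2.1) • ContinuousLinearMap.fst ℝ ℝ ℝ -
        ((u q).2.1 - (u' q).2.1) • ContinuousLinearMap.snd ℝ ℝ ℝ := by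
  let θ : R2 → (R2 →L[ℝ] ℝ) := fun q =>
    ((u q).2.2.1 - (u' q).2.2.1) • ContinuousLinearMap.fst ℝ ℝ ℝ -
        ((u q).2.1 - (u' q).2.1) • ContinuousLinearMap.snd ℝ ℝ ℝ
  have hθ : ∀ q ∈ Q, ContDiffAt ℝ ∞ θ q := by
    intro q hq
    have h1 := hu q hq
    have h2 := hu' q hq
    exact ((h1.snd.snd.fst.sub h2.snd.snd.fst).smul contDiffAt_const).sub
      ((h1.snd.fst.sub h2.snd.fst).smul contDiffAt_const)
  obtain ⟨F, hF⟩ := hQc.exists_forall_hasFDerivAt_of_fderiv_symmetric hQ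
    (show DifferentiableOn ℝ θ Q from fun q hq => ((hθ q hq).differentiableAt (by simp)).differentiableWithinAt) (by
      intro q hq x y
      have d1 := (hu q hq).differentiableAt (by simp)
      have d2 := (hu' q hq).differentiableAt (by simp)
      have c1 := sec_closed u q d1 ((hQ.eventually_mem hq).mono hs) (hi q hq) x y
      have c2 := sec_closed u' q d2 ((hQ.eventually_mem hq).mono hs') (hi' q hq) x y
      obtain ⟨-, a2, a3, -⟩ := comp_fderivs u q d1
      obtain ⟨-, b2, b3, -⟩ := comp_fderivs u' q d2
      have hd := ((a3.sub b3).smul_const (ContinuousLinearMap.fst ℝ ℝ ℝ)).sub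
        ((a2.sub b2).smul_const (ContinuousLinearMap.snd ℝ ℝ ℝ))
      have e : fderiv ℝ θ q = _ := hd.fderiv
      rw [e]
      simp
      linarith)
  have hFd : ∀ q ∈ Q, fderiv ℝ F q = θ q := fun q hq => (hF q hq).fderiv
  refine ⟨F, ?_, hFd⟩
  have : ContDiffOn ℝ ∞ F Q := by
    rw [contDiffOn_infty_iff_fderiv_of_isOpen hQ]
    refine ⟨fun q hq => (hF q hq).differentiableAt.differentiableWithinAt, ?_⟩
    exact ContDiffOn.congr (fun q hq => (hθ q hq).contDiffWithinAt) hFd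
  exact fun q hq => this.contDiffAt (hQ.mem_nhds hq)

def prL : R4 →L[ℝ] R2 := (ContinuousLinearMap.fst ℝ ℝ (ℝ × ℝ × ℝ)).prod
    ((ContinuousLinearMap.snd ℝ ℝ ℝ).comp ((ContinuousLinearMap.snd ℝ ℝ (ℝ × ℝ)).comp
      (ContinuousLinearMap.snd ℝ ℝ (ℝ × ℝ × ℝ))))

lemma prL_apply (w : R4) : prL w = (w.1, w.2.2.2) := rfl

lemma fderiv_prL (γ : R2 → R4) (hγ : ContDiff ℝ ∞ γ) (p v : R2) :
    fderiv ℝ (fun z => prL (γ z)) p v = prL (fderiv ℝ γ p v) := by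
  have := (prL.hasFDerivAt (x := γ p)).comp p (hγ.differentiable (by simp) p).hasFDerivAt
  have e : fderiv ℝ (fun z => prL (γ z)) p = _ := this.fderiv
  rw [e]; rfl

lemma iso_comp (γ : R2 → R4) (hγ : ContDiff ℝ ∞ γ)
    (hi : ∀ p u v, omega4 (fderiv ℝ γ p u) (fderiv ℝ γ p v) = 0) (τ : R2 → R2) (q : R2)
    (hτ : ContDiffAt ℝ ∞ τ q) (x y : R2) :
    omega4 (fderiv ℝ (fun q => γ (τ q)) q x) (fderiv ℝ (fun q => γ (τ q)) q y) = 0 := by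
  have := (hγ.differentiable (by simp) (τ q)).hasFDerivAt.comp q
    (hτ.differentiableAt (by simp)).hasFDerivAt
  have e : fderiv ℝ (fun q => γ (τ q)) q = _ := this.fderiv
  rw [e]
  exact hi _ _ _

lemma patch_core (a ε : ℝ) (hε : 0 < ε) (γ g : R2 → R4) (hγ : ContDiff ℝ ∞ γ) (hg : ContDiff ℝ ∞ g)
    (hγi : ∀ p u v, omega4 (fderiv ℝ γ p u) (fderiv ℝ γ p v) = 0)
    (hgi : ∀ p u v, omega4 (fderiv ℝ g p u) (fderiv ℝ g p v) = 0)
    (c : R4) (r : ℝ) (hr : 0 < r) (s : ℝ → R2) (σ' : R2 → R2) (Og : Set R2) (hOg : IsOpen Og)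
    (hσ' : ∀ q ∈ Og, ContDiffAt ℝ ∞ σ' q ∧ prL (g (σ' q)) = q)
    (hsc : ContinuousOn s (Metric.closedBall c.1 (2 * r)))
    (hs : ∀ b ∈ Metric.closedBall c.1 (2 * r), (b, a) ∈ Og ∧ γ (s b) = g (σ' (b, a)) ∧
      Function.Injective (fderiv ℝ (fun z => prL (γ z)) (s b))) :
    ∃ (τ : R2 → R2) (Ψ : ℝ × R4 → R4), Iso a ε Ψ ∧
      (∀ b, |b - c.1| < 2 * r → τ (b, a) = s b ∧ ContinuousAt τ (b, a) ∧
        (∀ᶠ x in 𝓝 ((b, a) : R2), prL (γ (τ x)) = x)) ∧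
      (∀ q : R4, q.2.2.2 = a → q ∉ Metric.closedBall c r → ∀ᶠ z in 𝓝 q, Ψ (1, z) = z) ∧
      (∀ q : R4, q.2.2.2 = a → |q.1 - c.1| < 2 * r →
        (∀ᶠ x in 𝓝 ((q.1, a) : R2), γ (τ x) = g (σ' x)) → ∀ᶠ z in 𝓝 q, Ψ (1, z) = z) ∧
      (∀ b, |b - c.1| < 2 * r → γ (s b) ∈ Metric.ball c (r / 2) →
        ∀ᶠ z in 𝓝 (s b), Ψ (1, γ z) ∈ Set.range g) := by
  have hm : ContDiff ℝ ∞ (fun z => prL (γ z)) := prL.contDiff.comp hγ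
  have hms : ∀ b ∈ Metric.closedBall c.1 (2 * r), prL (γ (s b)) = (b, a) := by
    intro b hb
    obtain ⟨h1, h2, h3⟩ := hs b hb
    rw [h2]; exact (hσ' _ h1).2
  have hinj : Set.InjOn (fun z => prL (γ z)) (s '' Metric.closedBall c.1 (2 * r)) := by
    rintro _ ⟨b, hb, rfl⟩ _ ⟨b', hb', rfl⟩ h
    simp only [hms b hb, hms b' hb'] at h
    exact congrArg s (Prod.ext_iff.1 h).1
  obtain ⟨Ω, O, τ, hΩ, hO, hNΩ, h1, h2⟩ := compact_local_inv (fun z => prL (γ z)) hm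
    (s '' Metric.closedBall c.1 (2 * r)) ((isCompact_closedBall _ _).image_of_continuousOn hsc) hinj
    (by rintro _ ⟨b, hb, rfl⟩; exact (hs b hb).2.2)
  have hτ : ∀ b ∈ Metric.closedBall c.1 (2 * r), (b, a) ∈ O ∧ τ (b, a) = s b := by
    intro b hb
    have h := h1 (s b) (hNΩ ⟨b, hb, rfl⟩)
    simp only [hms b hb] at h
    exact ⟨h.1, h.2.1⟩
  -- tube
  have htube : ∃ δ > 0, ∀ q : R2, |q.1 - c.1| < 2 * r → |q.2 - a| < δ → q ∈ O ∩ Og := by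
    obtain ⟨U, V, hU, hV, hCU, haV, hUV⟩ := generalized_tube_lemma
      (isCompact_closedBall c.1 (2 * r)) (isCompact_singleton (x := a)) (hO.inter hOg) (by
        rintro ⟨b, y⟩ ⟨hb, hy⟩
        rw [Set.mem_singleton_iff] at hy
        simp only at hy hb
        subst hy
        exact ⟨(hτ b hb).1, (hs b hb).1⟩)
    obtain ⟨δ, hδ, hball⟩ := Metric.isOpen_iff.1 hV a (haV rfl)
    refine ⟨δ, hδ, fun q hq1 hq2 => hUV ⟨hCU ?_, hball ?_⟩⟩
    · rw [Metric.mem_closedBall, Real.dist_eq]; exact hq1.le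
    · rw [Metric.mem_ball, Real.dist_eq]; exact hq2
  obtain ⟨δ, hδ, htube⟩ := htube
  let Q : Set R2 := Metric.ball c.1 (2 * r) ×ˢ Metric.ball a δ
  have hQo : IsOpen Q := Metric.isOpen_ball.prod Metric.isOpen_ball
  have hQc : Convex ℝ Q := (convex_ball _ _).prod (convex_ball _ _)
  have hQm : ∀ q : R2, q ∈ Q ↔ |q.1 - c.1| < 2 * r ∧ |q.2 - a| < δ := by
    intro q
    simp only [Q, Set.mem_prod, Metric.mem_ball, Real.dist_eq]
  have hQO : ∀ q ∈ Q, q ∈ O ∧ q ∈ Og := fun q hq => htube q ((hQm q).1 hq).1 ((hQm q).1 hq).2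
  have hQa : ∀ b, |b - c.1| < 2 * r → ((b, a) : R2) ∈ Q := fun b hb =>
    (hQm _).2 ⟨hb, by simpa using hδ⟩
  have hcb : ∀ b, |b - c.1| < 2 * r → b ∈ Metric.closedBall c.1 (2 * r) := by
    intro b hb
    rw [Metric.mem_closedBall, Real.dist_eq]; exact hb.le
  obtain ⟨F0, hF0, hF0d⟩ := primitive Q hQo hQc (fun q => γ (τ q)) (fun q => g (σ' q))
    (fun q hq => hγ.contDiffAt.comp q (h2 q (hQO q hq).1).2.2)
    (fun q hq => hg.contDiffAt.comp q (hσ' q (hQO q hq).2).1)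
    (fun q hq => by
      have := (h2 q (hQO q hq).1).2.1
      simp only [prL_apply] at this
      exact Prod.ext_iff.1 this)
    (fun q hq => by
      have := (hσ' q (hQO q hq).2).2
      simp only [prL_apply] at this
      exact Prod.ext_iff.1 this)
    (fun q hq x y => iso_comp γ hγ hγi τ q (h2 q (hQO q hq).1).2.2 x y)
    (fun q hq x y => iso_comp g hg hgi σ' q (hσ' q (hQO q hq).2).1 x y)
  have hγg : ∀ b, |b - c.1| < 2 * r → γ (τ (b, a)) = g (σ' (b, a)) := by
    intro b hb
    rw [(hτ b (hcb b hb)).2]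
    exact (hs b (hcb b hb)).2.1
  have hd1 : ∀ b, |b - c.1| < 2 * r → fderiv ℝ F0 (b, a) = 0 := by
    intro b hb
    rw [hF0d _ (hQa b hb)]
    simp only [hγg b hb]
    simp
  have hconst : ∀ b, |b - c.1| < 2 * r → F0 (b, a) = F0 (c.1, a) := by
    intro b hb
    have hk : ∀ x ∈ Metric.ball c.1 (2 * r), HasDerivAt (fun x => F0 (x, a)) 0 x := by
      intro x hx
      rw [Metric.mem_ball, Real.dist_eq] at hx
      have e := ((hF0 _ (hQa x hx)).differentiableAt (by simp)).hasFDerivAt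
      rw [hd1 x hx] at e
      have e2 : HasDerivAt (fun x : ℝ => ((x, a) : R2)) (1, 0) x :=
        (hasDerivAt_id x).prodMk (hasDerivAt_const x a)
      have := e.comp_hasDerivAt x e2
      exact this
    refine (Metric.isOpen_ball.is_const_of_deriv_eq_zero (𝕜 := ℝ) (s := Metric.ball c.1 (2 * r))
      (convex_ball _ _).isPreconnected
      (fun x hx => (hk x hx).differentiableAt.differentiableWithinAt)
      (fun x hx => (hk x hx).deriv) (x := b) (y := c.1) ?_ ?_)
    · rw [Metric.mem_ball, Real.dist_eq]; exact hb
    · exact Metric.mem_ball_self (by linarith)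
  let F : R2 → ℝ := fun q => F0 q - F0 (c.1, a)
  have hFd : ∀ q, fderiv ℝ F q = fderiv ℝ F0 q := fun q => fderiv_sub_const _
  obtain ⟨Ψ, hΨ, b1, b2, b3⟩ := bump_iso a ε hε c r δ hr hδ F
    (fun q h h' => (hF0 q ((hQm q).2 ⟨h, h'⟩)).sub contDiffAt_const)
    (fun b hb => sub_eq_zero.2 (hconst b hb))
    (fun b hb => by rw [hFd]; exact hd1 b hb)
  refine ⟨τ, Ψ, hΨ, ?_, b1, ?_, ?_⟩
  · intro b hb
    obtain ⟨e1, e2⟩ := hτ b (hcb b hb)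
    refine ⟨e2, (h2 _ e1).2.2.continuousAt, ?_⟩
    filter_upwards [hO.mem_nhds e1] with x hx
    exact (h2 x hx).2.1
  · intro q hq hq1 hq2
    apply b2 q hq hq1
    -- F vanishes near
    obtain ⟨ρ, hρ, hball⟩ := Metric.mem_nhds_iff.1
      (Filter.inter_mem hq2 (hQo.mem_nhds (hQa q.1 hq1)))
    filter_upwards [Metric.ball_mem_nhds _ hρ] with x hx
    have hc : F0 x = F0 (q.1, a) := by
      refine Metric.isOpen_ball.is_const_of_fderiv_eq_zero (𝕜 := ℝ)
        (s := Metric.ball ((q.1, a) : R2) ρ)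
        (convex_ball _ _).isPreconnected
        (fun y hy => ((hF0 y (hball hy).2).differentiableAt (by simp)).differentiableWithinAt)
        ?_ hx (Metric.mem_ball_self hρ)
      intro y hy
      have e : γ (τ y) = g (σ' y) := (hball hy).1
      rw [hF0d y (hball hy).2]
      simp only [e]
      simp
    simp only [F]
    rw [hc, hconst _ hq1, sub_self]
  · intro b hb hbb
    have hb' := hcb b hb
    have hpr := hms b hb'
    rw [prL_apply, Prod.ext_iff] at hpr
    simp only at hpr
    have h3 := b3 (γ (s b)) hpr.2 hbb
    have hΩm := hΩ.mem_nhds (hNΩ ⟨b, hb', rfl⟩)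
    have hmm : ∀ᶠ z in 𝓝 (s b), prL (γ z) ∈ Q := by
      apply hm.continuous.continuousAt.eventually_mem
      apply hQo.mem_nhds
      simp only [hms b hb']
      exact hQa b hb
    filter_upwards [hγ.continuous.continuousAt.eventually h3, hΩm, hmm] with z hz hz1 hz2
    refine ⟨σ' (prL (γ z)), ?_⟩
    have e1 : τ (prL (γ z)) = z := (h1 z hz1).2.1
    have e2 := (hσ' _ (hQO _ hz2).2).2
    rw [hz, ← prL_apply, hFd, hF0d _ hz2]
    simp only [e1]
    rw [prL_apply, prL_apply, Prod.ext_iff] at e2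
    rw [prL_apply]
    simp only at e2
    ext <;> simp [e2]

structure Adm (a : ℝ) (f γ : R2 → R4) : Prop where
  smooth : ContDiff ℝ ∞ γ
  iso : ∀ p u v, omega4 (fderiv ℝ γ p u) (fderiv ℝ γ p v) = 0
  eqA : ∀ p, (f p).2.2.2 = a → γ p = f p
  d4 : ∀ p, (f p).2.2.2 = a → ∀ v, (fderiv ℝ γ p v).2.2.2 = (fderiv ℝ f p v).2.2.2
  dk : ∀ p, (f p).2.2.2 = a → ∀ v, (fderiv ℝ f p v).2.2.2 = 0 → fderiv ℝ γ p v = fderiv ℝ f p v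

lemma Adm.inj {a : ℝ} {f γ : R2 → R4} (h : Adm a f γ) (hf : ContDiff ℝ ∞ f) (p : R2)
    (hp : (f p).2.2.2 = a) (hi : Function.Injective (fderiv ℝ (fun z => prL (f z)) p)) :
    Function.Injective (fderiv ℝ (fun z => prL (γ z)) p) := by
  rw [injective_iff_map_eq_zero]
  intro v hv
  have hv' := hv
  rw [fderiv_prL γ h.smooth] at hv
  have h4 : (fderiv ℝ γ p v).2.2.2 = 0 := (Prod.ext_iff.1 hv).2
  rw [h.d4 p hp] at h4
  rw [h.dk p hp v h4, ← fderiv_prL f hf] at hv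
  exact (injective_iff_map_eq_zero _).1 hi v hv

lemma patchA (a ε : ℝ) (hε : 0 < ε) (f g : R2 → R4) (hf : ContDiff ℝ ∞ f) (hg : ContDiff ℝ ∞ g)
    (hfe : Topology.IsInducing f) (hge : Topology.IsInducing g)
    (hgi : ∀ p u v, omega4 (fderiv ℝ g p u) (fderiv ℝ g p v) = 0)
    (hfg : ∀ p, (f p).2.2.2 = a → f p ∈ Set.range g) (p0 p0' : R2)
    (h0 : (f p0).2.2.2 = a) (h0' : g p0' = f p0)
    (hif : Function.Injective (fderiv ℝ (fun z => prL (f z)) p0))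
    (hig : Function.Injective (fderiv ℝ (fun z => prL (g z)) p0')) :
    ∃ N ∈ 𝓝 p0, ∀ γ, Adm a f γ → ∃ Ψ, Iso a ε Ψ ∧
      (∀ p ∈ N, (f p).2.2.2 = a → ∀ᶠ z in 𝓝 p, Ψ (1, γ z) ∈ Set.range g) ∧
      (∀ p, (f p).2.2.2 = a → (∀ᶠ z in 𝓝 p, γ z ∈ Set.range g) →
        ∀ᶠ z in 𝓝 p, Ψ (1, γ z) ∈ Set.range g) := by
  obtain ⟨Ωf, Of, σ, hΩf, hOf, hpf, f1, f2⟩ := compact_local_inv (fun z => prL (f z))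
    (prL.contDiff.comp hf) {p0} isCompact_singleton (Set.injOn_singleton _ _)
    (by rintro _ rfl; exact hif)
  obtain ⟨Ωg, Og, σ', hΩg, hOg, hpg, g1, g2⟩ := compact_local_inv (fun z => prL (g z))
    (prL.contDiff.comp hg) {p0'} isCompact_singleton (Set.injOn_singleton _ _)
    (by rintro _ rfl; exact hig)
  rw [Set.singleton_subset_iff] at hpf hpg
  obtain ⟨A1, hA1, eA1⟩ := hfe.isOpen_iff.1 hΩf
  obtain ⟨A2, hA2, eA2⟩ := hge.isOpen_iff.1 hΩg
  have hA : IsOpen (A1 ∩ A2) := hA1.inter hA2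
  have hA0 : f p0 ∈ A1 ∩ A2 := by
    refine ⟨?_, ?_⟩
    · have : p0 ∈ f ⁻¹' A1 := by rw [eA1]; exact hpf
      exact this
    · have : p0' ∈ g ⁻¹' A2 := by rw [eA2]; exact hpg
      rw [← h0']; exact this
  have hAf : ∀ p, f p ∈ A1 ∩ A2 → p ∈ Ωf := fun p hp => by rw [← eA1]; exact hp.1
  have hAg : ∀ p, g p ∈ A1 ∩ A2 → p ∈ Ωg := fun p hp => by rw [← eA2]; exact hp.2
  have hpr0 : prL (f p0) = ((f p0).1, a) := by rw [prL_apply, h0]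
  have m1 : ((f p0).1, a) ∈ Of := by rw [← hpr0]; exact (f1 p0 hpf).1
  have m2 : ((f p0).1, a) ∈ Og := by rw [← hpr0, ← h0']; exact (g1 p0' hpg).1
  have m3 : σ ((f p0).1, a) = p0 := by rw [← hpr0]; exact (f1 p0 hpf).2.1
  have hι : ContinuousAt (fun b : ℝ => ((b, a) : R2)) (f p0).1 := by fun_prop
  have hev : ∀ᶠ b : ℝ in 𝓝 (f p0).1, (b, a) ∈ Of ∧ (b, a) ∈ Og ∧ f (σ (b, a)) ∈ A1 ∩ A2 := by
    refine (hι.eventually_mem (hOf.mem_nhds m1)).and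
      ((hι.eventually_mem (hOg.mem_nhds m2)).and ?_)
    have c1 : ContinuousAt (fun q => f (σ q)) ((f p0).1, a) :=
      hf.continuous.continuousAt.comp (f2 _ m1).2.2.continuousAt
    have c2 : ContinuousAt (fun b : ℝ => f (σ (b, a))) (f p0).1 :=
      ContinuousAt.comp (f := fun b : ℝ => ((b, a) : R2)) (g := fun q => f (σ q)) c1 hι
    refine c2.eventually_mem (hA.mem_nhds ?_)
    simp only [m3]
    exact hA0
  obtain ⟨e1, he1, hb1⟩ := Metric.eventually_nhds_iff.1 hev
  obtain ⟨e2, he2, hb2⟩ := Metric.isOpen_iff.1 hA _ hA0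
  obtain ⟨r, hr, hr1, hr2⟩ : ∃ r > 0, 2 * r < e1 ∧ r < e2 :=
    ⟨min e1 e2 / 4, by positivity, by linarith [min_le_left e1 e2],
      by linarith [min_le_right e1 e2, lt_min he1 he2]⟩
  have hball : ∀ w, w ∈ Metric.closedBall (f p0) r → w ∈ A1 ∩ A2 := by
    intro w hw
    exact hb2 ((Metric.mem_closedBall.1 hw).trans_lt hr2)
  have hB : ∀ b ∈ Metric.closedBall (f p0).1 (2 * r),
      (b, a) ∈ Of ∧ (b, a) ∈ Og ∧ f (σ (b, a)) ∈ A1 ∩ A2 :=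
    fun b hb => hb1 ((Metric.mem_closedBall.1 hb).trans_lt hr1)
  have hT : ∀ b ∈ Metric.closedBall (f p0).1 (2 * r), (f (σ (b, a))).2.2.2 = a := by
    intro b hb
    have := (f2 _ (hB b hb).1).2.1
    exact (Prod.ext_iff.1 this).2
  have hback : ∀ p, (f p).2.2.2 = a → f p ∈ Metric.closedBall (f p0) r →
      |(f p).1 - (f p0).1| < 2 * r ∧ σ ((f p).1, a) = p := by
    intro p hp hpb
    refine ⟨?_, ?_⟩
    · rw [Metric.mem_closedBall, Prod.dist_eq] at hpb
      have := (le_max_left _ _).trans hpb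
      rw [Real.dist_eq] at this
      linarith
    · have := (f1 p (hAf p (hball _ hpb))).2.1
      simp only [prL_apply, hp] at this
      exact this
  refine ⟨f ⁻¹' Metric.ball (f p0) (r / 2), hf.continuous.continuousAt.preimage_mem_nhds
    (Metric.ball_mem_nhds _ (by linarith)), ?_⟩
  intro γ hγ
  obtain ⟨τ, Ψ, hΨ, t1, t2, t3, t4⟩ := patch_core a ε hε γ g hγ.smooth hg hγ.iso hgi (f p0) r hr
    (fun b => σ (b, a)) σ' Og hOg (fun q hq => ⟨(g2 q hq).2.2, (g2 q hq).2.1⟩)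
    (by
      intro b hb
      have c1 : ContinuousAt (fun b : ℝ => ((b, a) : R2)) b := by fun_prop
      exact (ContinuousAt.comp (f := fun b : ℝ => ((b, a) : R2)) (g := σ)
        (f2 _ (hB b hb).1).2.2.continuousAt c1).continuousWithinAt)
    (by
      intro b hb
      obtain ⟨k1, k2, k3⟩ := hB b hb
      refine ⟨k2, ?_, ?_⟩
      · rw [hγ.eqA _ (hT b hb)]
        obtain ⟨z, hz⟩ := hfg _ (hT b hb)
        have hzΩ : z ∈ Ωg := hAg z (by rw [hz]; exact k3)
        have e := (g1 z hzΩ).2.1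
        have e' : prL (f (σ (b, a))) = (b, a) := (f2 _ k1).2.1
        simp only [hz, e'] at e
        rw [e, hz]
      · exact hγ.inj hf _ (hT b hb) (f1 _ (f2 _ k1).1).2.2)
  refine ⟨Ψ, hΨ, ?_, ?_⟩
  · intro p hpN hp
    have hpN' : f p ∈ Metric.ball (f p0) (r / 2) := hpN
    have hpc : f p ∈ Metric.closedBall (f p0) r :=
      Metric.ball_subset_closedBall (Metric.ball_subset_ball (by linarith) hpN')
    obtain ⟨k1, k2⟩ := hback p hp hpc
    have := t4 (f p).1 k1 (by simp only [k2]; rw [hγ.eqA p hp]; exact hpN')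
    simp only [k2] at this
    exact this
  · intro p hp hgood
    have hid : (∀ᶠ w in 𝓝 (f p), Ψ (1, w) = w) → ∀ᶠ z in 𝓝 p, Ψ (1, γ z) ∈ Set.range g := by
      intro h
      rw [← hγ.eqA p hp] at h
      filter_upwards [hγ.smooth.continuous.continuousAt.eventually h, hgood] with z h1 h2
      rw [h1]; exact h2
    apply hid
    by_cases hpc : f p ∈ Metric.closedBall (f p0) r
    · obtain ⟨k1, k2⟩ := hback p hp hpc
      refine t3 (f p) hp k1 ?_
      obtain ⟨s1, s2, s3⟩ := t1 _ k1
      have s1' : τ ((f p).1, a) = p := s1.trans k2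
      have hAγ : ∀ᶠ z in 𝓝 p, γ z ∈ A1 ∩ A2 := by
        apply hγ.smooth.continuous.continuousAt.eventually_mem
        apply hA.mem_nhds
        rw [hγ.eqA p hp]
        exact hball _ hpc
      have hτt : Tendsto τ (𝓝 ((f p).1, a)) (𝓝 p) := by
        have := s2.tendsto
        rwa [s1'] at this
      filter_upwards [s3, hτt.eventually hAγ, hτt.eventually hgood] with x x1 x2 x3
      obtain ⟨z, hz⟩ := x3
      have hzΩ : z ∈ Ωg := hAg z (by rw [hz]; exact x2)
      have e := (g1 z hzΩ).2.1
      simp only [hz, x1] at e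
      rw [e, hz]
    · exact t2 _ hp hpc

structure Rot (R R' : R4 →L[ℝ] R4) : Prop where
  left : ∀ w, R' (R w) = w
  right : ∀ w, R (R' w) = w
  symp : ∀ u v, omega4 (R u) (R v) = omega4 u v
  y : ∀ w, (R w).2.2.2 = w.2.2.2

def rotL (p q r s : ℝ) : R4 →L[ℝ] R4 :=
  (p • ContinuousLinearMap.fst ℝ ℝ (ℝ × ℝ × ℝ) + q • ((ContinuousLinearMap.fst ℝ ℝ ℝ).comp
      ((ContinuousLinearMap.snd ℝ ℝ (ℝ × ℝ)).comp
      (ContinuousLinearMap.snd ℝ ℝ (ℝ × ℝ × ℝ))))).prod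
  (((ContinuousLinearMap.fst ℝ ℝ (ℝ × ℝ)).comp (ContinuousLinearMap.snd ℝ ℝ (ℝ × ℝ × ℝ))).prod
  ((r • ContinuousLinearMap.fst ℝ ℝ (ℝ × ℝ × ℝ) + s • ((ContinuousLinearMap.fst ℝ ℝ ℝ).comp
      ((ContinuousLinearMap.snd ℝ ℝ (ℝ × ℝ)).comp
      (ContinuousLinearMap.snd ℝ ℝ (ℝ × ℝ × ℝ))))).prod
  ((ContinuousLinearMap.snd ℝ ℝ ℝ).comp
      ((ContinuousLinearMap.snd ℝ ℝ (ℝ × ℝ)).comp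
      (ContinuousLinearMap.snd ℝ ℝ (ℝ × ℝ × ℝ))))))

lemma rotL_apply (p q r s : ℝ) (w : R4) :
    rotL p q r s w = (p * w.1 + q * w.2.2.1, w.2.1, r * w.1 + s * w.2.2.1, w.2.2.2) := rfl

lemma rotL_rot (p q r s : ℝ) (h : p * s - q * r = 1) : Rot (rotL p q r s) (rotL s (-q) (-r) p) where
  left := fun w => by
    simp only [rotL_apply]
    ext
    · simp only; linear_combination w.1 * h
    · rfl
    · simp only; linear_combination w.2.2.1 * h
    · rfl
  right := fun w => by
    simp only [rotL_apply]
    ext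
    · simp only; linear_combination w.1 * h
    · rfl
    · simp only; linear_combination w.2.2.1 * h
    · rfl
  symp := fun u v => by
    simp only [rotL_apply, omega4]
    linear_combination (u.1 * v.2.2.1 - u.2.2.1 * v.1) * h
  y := fun w => rfl

lemma Rot.swap {R R' : R4 →L[ℝ] R4} (h : Rot R R') : Rot R' R where
  left := h.right
  right := h.left
  symp := fun u v => by rw [← h.symp, h.right, h.right]
  y := fun w => by rw [← h.y, h.right]

lemma Iso.conj {a ε : ℝ} {Ψ : ℝ × R4 → R4} (hΨ : Iso a ε Ψ) {R R' : R4 →L[ℝ] R4}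
    (h : Rot R R') : Iso a ε (fun p => R' (Ψ (p.1, R p.2))) where
  smooth := R'.contDiff.comp (hΨ.smooth.comp (contDiff_fst.prodMk (R.contDiff.comp contDiff_snd)))
  zero := fun p => by simp only [hΨ.zero, h.left]
  bij := fun t => by
    have b1 : Function.Bijective R := ⟨Function.LeftInverse.injective h.left,
      Function.RightInverse.surjective h.right⟩
    have b2 : Function.Bijective R' := ⟨Function.LeftInverse.injective h.right,
      Function.RightInverse.surjective h.left⟩
    exact b2.comp ((hΨ.bij t).comp b1)
  symp := by
    intro t p u v
    have e := (R'.hasFDerivAt (x := Ψ (t, R p))).comp p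
      ((((hΨ.smooth_t t).differentiable (by simp) (R p)).hasFDerivAt).comp p
        (R.hasFDerivAt (x := p)))
    have e' : fderiv ℝ (fun p => R' (Ψ (t, R p))) p = _ := e.fderiv
    simp only [e', ContinuousLinearMap.comp_apply]
    rw [h.swap.symp, hΨ.symp, h.symp]
  fixA := fun t p hp => by
    simp only
    rw [hΨ.fixA t (R p) (by rw [h.y, hp]), h.left]
  fixOut := fun t p hp => by
    simp only
    rw [hΨ.fixOut t (R p) (by rw [h.y]; exact hp), h.left]

lemma fderiv_clm (R : R4 →L[ℝ] R4) (γ : R2 → R4) (hγ : ContDiff ℝ ∞ γ) (p v : R2) :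
    fderiv ℝ (fun z => R (γ z)) p v = R (fderiv ℝ γ p v) := by
  have := (R.hasFDerivAt (x := γ p)).comp p (hγ.differentiable (by simp) p).hasFDerivAt
  have e : fderiv ℝ (fun z => R (γ z)) p = _ := this.fderiv
  rw [e]; rfl

lemma Adm.rot {a : ℝ} {f γ : R2 → R4} (h : Adm a f γ) (hf : ContDiff ℝ ∞ f) {R R' : R4 →L[ℝ] R4}
    (hR : Rot R R') : Adm a (fun z => R (f z)) (fun z => R (γ z)) where
  smooth := R.contDiff.comp h.smooth
  iso := fun p u v => by
    rw [fderiv_clm R γ h.smooth, fderiv_clm R γ h.smooth, hR.symp, h.iso]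
  eqA := fun p hp => by
    rw [hR.y] at hp
    simp only [h.eqA p hp]
  d4 := fun p hp v => by
    rw [hR.y] at hp
    rw [fderiv_clm R γ h.smooth, fderiv_clm R f hf, hR.y, hR.y, h.d4 p hp]
  dk := fun p hp v hv => by
    rw [hR.y] at hp
    rw [fderiv_clm R f hf, hR.y] at hv
    rw [fderiv_clm R γ h.smooth, fderiv_clm R f hf, h.dk p hp v hv]

lemma tangent (D : R2 →L[ℝ] R4) (hD : Function.Injective D)
    (hi : ∀ u v, omega4 (D u) (D v) = 0) (w0 : R2) (hw : (D w0).2.2.2 ≠ 0) :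
    ∃ x0 y0 : ℝ, (x0 ≠ 0 ∨ y0 ≠ 0) ∧ ∀ p q : ℝ, p * x0 + q * y0 ≠ 0 →
      ∀ v, (D v).2.2.2 = 0 → p * (D v).1 + q * (D v).2.2.1 = 0 → v = 0 := by
  have hlin : ∀ v : R2, D v = v.1 • D (1, 0) + v.2 • D (0, 1) := by
    intro v
    rw [← map_smul, ← map_smul, ← map_add]
    congr 1
    ext <;> simp
  obtain ⟨l1, hl1⟩ : ∃ l, l = (D (1, 0)).2.2.2 := ⟨_, rfl⟩
  obtain ⟨l2, hl2⟩ : ∃ l, l = (D (0, 1)).2.2.2 := ⟨_, rfl⟩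
  have hl : ∀ v : R2, (D v).2.2.2 = v.1 * l1 + v.2 * l2 := by
    intro v
    rw [hlin v, hl1, hl2]
    rfl
  have hne : l1 ^ 2 + l2 ^ 2 ≠ 0 := by
    intro h
    have a1 : l1 = 0 := by nlinarith [sq_nonneg l1, sq_nonneg l2]
    have a2 : l2 = 0 := by nlinarith [sq_nonneg l1, sq_nonneg l2]
    apply hw
    rw [hl, a1, a2]; ring
  have hker : ∀ v : R2, (D v).2.2.2 = 0 → ∃ k : ℝ, v = k • ((-l2, l1) : R2) := by
    intro v hv
    rw [hl] at hv
    refine ⟨(v.2 * l1 - v.1 * l2) / (l1 ^ 2 + l2 ^ 2), ?_⟩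
    ext
    · simp only [Prod.smul_mk, smul_eq_mul]
      field_simp
      linear_combination l1 * hv
    · simp only [Prod.smul_mk, smul_eq_mul]
      field_simp
      linear_combination l2 * hv
  have hv0 : (D (-l2, l1)).2.2.2 = 0 := by rw [hl]; ring
  refine ⟨(D (-l2, l1)).1, (D (-l2, l1)).2.2.1, ?_, ?_⟩
  · by_contra hcon
    push Not at hcon
    have h1 := hi (-l2, l1) w0
    simp only [omega4, hcon.1, hcon.2, hv0] at h1
    have h2 : (D (-l2, l1)).2.1 = 0 := by
      have : (D (-l2, l1)).2.1 * (D w0).2.2.2 = 0 := by linarith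
      exact (mul_eq_zero.1 this).resolve_right hw
    have h3 : D (-l2, l1) = D 0 := by
      rw [map_zero]
      ext
      · exact hcon.1
      · exact h2
      · exact hcon.2
      · exact hv0
    have h4 := Prod.ext_iff.1 (hD h3)
    simp at h4
    apply hne
    rw [h4.1, h4.2]; ring
  · intro p q hpq v hv hv2
    obtain ⟨k, rfl⟩ := hker v hv
    rw [map_smul] at hv2
    have : k * (p * (D (-l2, l1)).1 + q * (D (-l2, l1)).2.2.1) = 0 := by
      rw [← hv2]
      simp only [Prod.smul_fst, Prod.smul_snd, smul_eq_mul]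
      ring
    rw [(mul_eq_zero.1 this).resolve_right hpq, zero_smul]

lemma patch (a ε : ℝ) (hε : 0 < ε) (f g : R2 → R4) (hf : ContDiff ℝ ∞ f) (hg : ContDiff ℝ ∞ g)
    (hfe : Topology.IsInducing f) (hge : Topology.IsInducing g)
    (hfi : ∀ p u v, omega4 (fderiv ℝ f p u) (fderiv ℝ f p v) = 0)
    (hgi : ∀ p u v, omega4 (fderiv ℝ g p u) (fderiv ℝ g p v) = 0)
    (hfm : ∀ p, Function.Injective (fderiv ℝ f p)) (hgm : ∀ p, Function.Injective (fderiv ℝ g p))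
    (hfg : ∀ p, (f p).2.2.2 = a → f p ∈ Set.range g) (p0 p0' : R2)
    (h0 : (f p0).2.2.2 = a) (h0' : g p0' = f p0)
    (hft : ∃ w, (fderiv ℝ f p0 w).2.2.2 ≠ 0) (hgt : ∃ w, (fderiv ℝ g p0' w).2.2.2 ≠ 0) :
    ∃ N ∈ 𝓝 p0, ∀ γ, Adm a f γ → ∃ Ψ, Iso a ε Ψ ∧
      (∀ p ∈ N, (f p).2.2.2 = a → ∀ᶠ z in 𝓝 p, Ψ (1, γ z) ∈ Set.range g) ∧
      (∀ p, (f p).2.2.2 = a → (∀ᶠ z in 𝓝 p, γ z ∈ Set.range g) →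
        ∀ᶠ z in 𝓝 p, Ψ (1, γ z) ∈ Set.range g) := by
  obtain ⟨w, hw⟩ := hft
  obtain ⟨w', hw'⟩ := hgt
  obtain ⟨x, y, hxy, hk⟩ := tangent _ (hfm p0) (hfi p0) w hw
  obtain ⟨x', y', hxy', hk'⟩ := tangent _ (hgm p0') (hgi p0') w' hw'
  obtain ⟨p, q, r, s, hdet, hpq, hpq'⟩ : ∃ p q r s : ℝ, p * s - q * r = 1 ∧ p * x + q * y ≠ 0 ∧
      p * x' + q * y' ≠ 0 := by
    by_cases hx : x ≠ 0 ∧ x' ≠ 0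
    · exact ⟨1, 0, 0, 1, by norm_num, by simpa using hx.1, by simpa using hx.2⟩
    by_cases hy : y ≠ 0 ∧ y' ≠ 0
    · exact ⟨0, 1, -1, 0, by norm_num, by simpa using hy.1, by simpa using hy.2⟩
    refine ⟨1, 1, 0, 1, by norm_num, ?_, ?_⟩ <;> grind
  have hR := rotL_rot p q r s hdet
  obtain ⟨R, hRd⟩ : ∃ R, R = rotL p q r s := ⟨_, rfl⟩
  obtain ⟨R', hRd'⟩ : ∃ R', R' = rotL s (-q) (-r) p := ⟨_, rfl⟩
  rw [← hRd, ← hRd'] at hR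
  have hRi : Topology.IsInducing R := by
    exact (ContinuousLinearEquiv.equivOfInverse R R' hR.left hR.right).toHomeomorph.isInducing
  have hinj : ∀ (k : R2 → R4), ContDiff ℝ ∞ k → ∀ z, (∀ v, (fderiv ℝ k z v).2.2.2 = 0 →
      p * (fderiv ℝ k z v).1 + q * (fderiv ℝ k z v).2.2.1 = 0 → v = 0) →
      Function.Injective (fderiv ℝ (fun z => prL (R (k z))) z) := by
    intro k hks z hkz
    rw [injective_iff_map_eq_zero]
    intro v hv
    rw [fderiv_prL (fun z => R (k z)) (R.contDiff.comp hks), fderiv_clm R k hks, hRd,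
      rotL_apply, prL_apply] at hv
    exact hkz v (Prod.ext_iff.1 hv).2 (Prod.ext_iff.1 hv).1
  obtain ⟨N, hN, hpatch⟩ := patchA a ε hε (fun z => R (f z)) (fun z => R (g z))
    (R.contDiff.comp hf) (R.contDiff.comp hg) (hRi.comp hfe) (hRi.comp hge)
    (fun p u v => by rw [fderiv_clm R g hg, fderiv_clm R g hg, hR.symp, hgi])
    (fun p hp => by
      rw [hR.y] at hp
      obtain ⟨z, hz⟩ := hfg p hp
      exact ⟨z, by simp only [hz]⟩)
    p0 p0' (by rw [hR.y, h0]) (by simp only [h0'])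
    (hinj f hf p0 (hk p q hpq)) (hinj g hg p0' (hk' p q hpq'))
  refine ⟨N, hN, fun γ hγ => ?_⟩
  obtain ⟨Ψ, hΨ, h1, h2⟩ := hpatch _ (hγ.rot hf hR)
  have hr : ∀ w, w ∈ Set.range (fun z => R (g z)) → R' w ∈ Set.range g := by
    rintro _ ⟨z, rfl⟩
    exact ⟨z, (hR.left _).symm⟩
  refine ⟨_, hΨ.conj hR, ?_, ?_⟩
  · intro p hpN hp
    exact (h1 p hpN (by rw [hR.y]; exact hp)).mono fun z hz => hr _ hz
  · intro p hp hgood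
    refine (h2 p (by rw [hR.y]; exact hp) (hgood.mono ?_)).mono fun z hz => hr _ hz
    rintro z ⟨y, hy⟩
    exact ⟨y, by simp only [hy]⟩

lemma Iso.fderiv_ker {a ε : ℝ} {Φ : ℝ × R4 → R4} (h : Iso a ε Φ) (q u : R4) (hq : q.2.2.2 = a)
    (hu : u.2.2.2 = 0) : fderiv ℝ (fun p => Φ (1, p)) q u = u := by
  have e1 : HasDerivAt (fun t : ℝ => q + t • u) u 0 := by
    simpa using ((hasDerivAt_id (0 : ℝ)).smul_const u).const_add q
  have e2 : HasFDerivAt (fun p => Φ (1, p)) (fderiv ℝ (fun p => Φ (1, p)) q) (q + (0 : ℝ) • u) := by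
    rw [zero_smul, add_zero]
    exact ((h.smooth_t 1).differentiable (by simp) q).hasFDerivAt
  have e3 := e2.comp_hasDerivAt (0 : ℝ) e1
  have e4 : ((fun p => Φ (1, p)) ∘ fun t : ℝ => q + t • u) = fun t : ℝ => q + t • u := by
    funext t
    apply h.fixA
    simp [hq, hu]
  rw [e4] at e3
  exact e3.unique e1

lemma Iso.fderiv_y {a ε : ℝ} {Φ : ℝ × R4 → R4} (h : Iso a ε Φ) (q u : R4) (hq : q.2.2.2 = a) :
    (fderiv ℝ (fun p => Φ (1, p)) q u).2.2.2 = u.2.2.2 := by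
  have h1 := h.symp 1 q u (0, 1, 0, 0)
  rw [h.fderiv_ker q (0, 1, 0, 0) hq rfl] at h1
  simp only [omega4] at h1
  linarith

lemma Iso.adm {a ε : ℝ} {Φ : ℝ × R4 → R4} (h : Iso a ε Φ) (f : R2 → R4) (hf : ContDiff ℝ ∞ f)
    (hfi : ∀ p u v, omega4 (fderiv ℝ f p u) (fderiv ℝ f p v) = 0) :
    Adm a f (fun z => Φ (1, f z)) := by
  have hd : ∀ p v, fderiv ℝ (fun z => Φ (1, f z)) p v =
      fderiv ℝ (fun p => Φ (1, p)) (f p) (fderiv ℝ f p v) := by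
    intro p v
    have := (((h.smooth_t 1).differentiable (by simp) (f p)).hasFDerivAt).comp p
      (hf.differentiable (by simp) p).hasFDerivAt
    have e : fderiv ℝ (fun z => Φ (1, f z)) p = _ := this.fderiv
    rw [e]; rfl
  refine ⟨(h.smooth_t 1).comp hf, ?_, ?_, ?_, ?_⟩
  · intro p u v
    rw [hd, hd, h.symp, hfi]
  · intro p hp
    exact h.fixA 1 _ hp
  · intro p hp v
    rw [hd, h.fderiv_y _ _ hp]
  · intro p hp v hv
    rw [hd, h.fderiv_ker _ _ hp hv]

lemma flat_inducing (f : R2 → R4) (h : IsFlatParam f) : Topology.IsInducing f := by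
  obtain ⟨h1, h2, h3, -⟩ := h
  exact (Topology.IsClosedEmbedding.of_continuous_injective_isClosedMap h1.continuous h2
    h3.isClosedMap).isInducing

lemma flat_trans (f : R2 → R4) (h : IsFlatParam f) (a : ℝ)
    (ht : ∀ p : R2, (f p).2.2.2 = a → fderiv ℝ (fun q => (f q).2.2.2) p ≠ 0) (p : R2)
    (hp : (f p).2.2.2 = a) : ∃ w, (fderiv ℝ f p w).2.2.2 ≠ 0 := by
  by_contra hcon
  push Not at hcon
  apply ht p hp
  obtain ⟨-, -, -, h4⟩ := comp_fderivs f p (h.1.differentiable (by simp) p)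
  rw [h4.fderiv]
  ext
  exact hcon _
  exact hcon _

lemma flat_compact (f : R2 → R4) (h : IsFlatParam f) (a : ℝ)
    (ht : ∀ p : R2, (f p).2.2.2 = a → fderiv ℝ (fun q => (f q).2.2.2) p ≠ 0) :
    IsCompact {p : R2 | (f p).2.2.2 = a} := by
  obtain ⟨h1, -, -, -, -, K, hK, hKf⟩ := h
  have hcont : Continuous (fun p => (f p).2.2.2) := by
    have := h1.continuous
    fun_prop
  have hcl : IsClosed {p : R2 | (f p).2.2.2 = a} := isClosed_eq hcont continuous_const
  refine hK.of_isClosed_subset hcl ?_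
  intro p hp
  by_contra hpK
  apply ht p hp
  have hev : (fun q => (f q).2.2.2) =ᶠ[𝓝 p] fun _ => 0 := by
    filter_upwards [hK.isClosed.isOpen_compl.mem_nhds hpK] with q hq
    rw [hKf q hq]
  rw [hev.fderiv_eq]
  simp

lemma main_iso (a ε : ℝ) (hε : 0 < ε) (f g : R2 → R4) (hf : IsFlatParam f) (hg : IsFlatParam g)
    (hft : ∀ p : R2, (f p).2.2.2 = a → fderiv ℝ (fun q => (f q).2.2.2) p ≠ 0)
    (hgt : ∀ p : R2, (g p).2.2.2 = a → fderiv ℝ (fun q => (g q).2.2.2) p ≠ 0)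
    (hfg : ∀ p, (f p).2.2.2 = a → f p ∈ Set.range g) :
    ∃ Ψ, Iso a ε Ψ ∧ ∀ p, (f p).2.2.2 = a → ∀ᶠ z in 𝓝 p, Ψ (1, f z) ∈ Set.range g := by
  have key : ∀ Φ, Iso a ε Φ → ∃ Ψ, Iso a ε Ψ ∧
      (∀ p ∈ {p : R2 | (f p).2.2.2 = a}, (f p).2.2.2 = a →
        ∀ᶠ z in 𝓝 p, Ψ (1, Φ (1, f z)) ∈ Set.range g) ∧
      (∀ p, (f p).2.2.2 = a → (∀ᶠ z in 𝓝 p, Φ (1, f z) ∈ Set.range g) →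
        ∀ᶠ z in 𝓝 p, Ψ (1, Φ (1, f z)) ∈ Set.range g) := by
    refine (flat_compact f hf a hft).induction_on (p := fun A => ∀ Φ, Iso a ε Φ → ∃ Ψ, Iso a ε Ψ ∧
      (∀ p ∈ A, (f p).2.2.2 = a →
        ∀ᶠ z in 𝓝 p, Ψ (1, Φ (1, f z)) ∈ Set.range g) ∧
      (∀ p, (f p).2.2.2 = a → (∀ᶠ z in 𝓝 p, Φ (1, f z) ∈ Set.range g) →
        ∀ᶠ z in 𝓝 p, Ψ (1, Φ (1, f z)) ∈ Set.range g)) ?_ ?_ ?_ ?_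
    · intro Φ hΦ
      exact ⟨_, Iso.id a ε, fun p hp => hp.elim, fun p hp h => h⟩
    · intro A B hAB hB Φ hΦ
      obtain ⟨Ψ, h1, h2, h3⟩ := hB Φ hΦ
      exact ⟨Ψ, h1, fun p hp => h2 p (hAB hp), h3⟩
    · intro A B hA hB Φ hΦ
      obtain ⟨Ψ, h1, h2, h3⟩ := hA Φ hΦ
      obtain ⟨Ψ', h1', h2', h3'⟩ := hB _ (h1.comp hΦ)
      refine ⟨_, h1'.comp h1, ?_, ?_⟩
      · rintro p (hp | hp) hpa
        · exact h3' p hpa (h2 p hp hpa)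
        · exact h2' p hp hpa
      · intro p hpa hgood
        exact h3' p hpa (h3 p hpa hgood)
    · intro p0 hp0
      obtain ⟨p0', hp0'⟩ := hfg p0 hp0
      obtain ⟨N, hN, hpatch⟩ := patch a ε hε f g hf.1 hg.1 (flat_inducing f hf)
        (flat_inducing g hg) hf.2.2.2.2.1 hg.2.2.2.2.1 hf.2.2.2.1 hg.2.2.2.1 hfg p0 p0' hp0 hp0'
        (flat_trans f hf a hft p0 hp0)
        (flat_trans g hg a hgt p0' (by rw [hp0']; exact hp0))
      refine ⟨N, mem_nhdsWithin_of_mem_nhds hN, ?_⟩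
      intro Φ hΦ
      exact hpatch _ (hΦ.adm f hf.1 hf.2.2.2.2.1)
  obtain ⟨Ψ, h1, h2, -⟩ := key _ (Iso.id a ε)
  exact ⟨Ψ, h1, fun p hp => h2 p hp hp⟩

/-- Equivalence of collar neighborhoods of a common slice. -/
theorem collar_equivalence (L L' : Set R4) (a : ℝ)
    (hL : IsFlatLagrangian L) (hL' : IsFlatLagrangian L')
    (hLt : TransverseAt L a) (hL't : TransverseAt L' a)
    (S : Set R4) (hSL : L ∩ {p : R4 | p.2.2.2 = a} = S)
    (hSL' : L' ∩ {p : R4 | p.2.2.2 = a} = S)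
    (ε : ℝ) (hε : 0 < ε) :
    ∃ (V U : Set R4) (Φ : ℝ × R4 → R4),
      V ⊆ U ∧ U ⊆ L ∧
      IsOpen (Subtype.val ⁻¹' U : Set L) ∧ IsOpen (Subtype.val ⁻¹' V : Set L) ∧
      S ⊆ V ∧ S ⊆ U ∧
      ContDiff ℝ (⊤ : ℕ∞) Φ ∧ (∀ p : R4, Φ (0, p) = p) ∧
      (∀ t : ℝ, IsSymplectomorphism (fun p => Φ (t, p))) ∧
      (∀ t : ℝ, ∀ p ∈ S ∪ (L \ U), Φ (t, p) = p) ∧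
      ((fun p => Φ (1, p)) '' U ⊆ {p : R4 | a - ε < p.2.2.2 ∧ p.2.2.2 < a + ε}) ∧
      ((fun p => Φ (1, p)) '' V ⊆ L') := by
  obtain ⟨f, hf, rfl, hft⟩ := hLt
  obtain ⟨g, hg, rfl, hgt⟩ := hL't
  have hfg : ∀ p, (f p).2.2.2 = a → f p ∈ Set.range g := by
    intro p hp
    have : f p ∈ S := by rw [← hSL]; exact ⟨⟨p, rfl⟩, hp⟩
    rw [← hSL'] at this
    exact this.1
  obtain ⟨Ψ, hΨ, hgood⟩ := main_iso a ε hε f g hf hg hft hgt hfg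
  have hy4 : Continuous (fun p : R4 => p.2.2.2) := by fun_prop
  have hslab : IsOpen {p : R4 | |p.2.2.2 - a| < ε} :=
    isOpen_lt (by fun_prop) continuous_const
  obtain ⟨B, hB, eB⟩ := (flat_inducing f hf).isOpen_iff.1
    (isOpen_interior (s := {z | Ψ (1, f z) ∈ Set.range g}))
  have hBm : ∀ p, f p ∈ B → Ψ (1, f p) ∈ Set.range g := by
    intro p hp
    have : p ∈ f ⁻¹' B := hp
    rw [eB] at this
    exact (interior_subset : _ ⊆ {z | Ψ (1, f z) ∈ Set.range g}) this
  have hSB : ∀ p ∈ S, p ∈ Set.range f ∧ p ∈ B ∧ p.2.2.2 = a := by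
    intro p hp
    rw [← hSL] at hp
    obtain ⟨⟨z, rfl⟩, hz⟩ := hp
    refine ⟨⟨z, rfl⟩, ?_, hz⟩
    have : z ∈ interior {z | Ψ (1, f z) ∈ Set.range g} := mem_interior_iff_mem_nhds.2 (hgood z hz)
    rw [← eB] at this
    exact this
  have hSsl : ∀ p ∈ S, |p.2.2.2 - a| < ε := by
    intro p hp
    rw [(hSB p hp).2.2, sub_self, abs_zero]; exact hε
  refine ⟨Set.range f ∩ ({p : R4 | |p.2.2.2 - a| < ε} ∩ B),
    Set.range f ∩ {p : R4 | |p.2.2.2 - a| < ε}, Ψ, ?_, Set.inter_subset_left, ?_, ?_, ?_, ?_,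
    hΨ.smooth, hΨ.zero, hΨ.isSymp, ?_, ?_, ?_⟩
  · rintro p ⟨h1, h2, h3⟩
    exact ⟨h1, h2⟩
  · rw [Subtype.preimage_coe_self_inter]
    exact hslab.preimage continuous_subtype_val
  · rw [Subtype.preimage_coe_self_inter]
    exact (hslab.inter hB).preimage continuous_subtype_val
  · intro p hp
    exact ⟨(hSB p hp).1, hSsl p hp, (hSB p hp).2.1⟩
  · intro p hp
    exact ⟨(hSB p hp).1, hSsl p hp⟩
  · rintro t p (hp | ⟨hp1, hp2⟩)
    · exact hΨ.fixA t p (hSB p hp).2.2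
    · apply hΨ.fixOut t p
      by_contra h
      exact hp2 ⟨hp1, not_le.1 h⟩
  · rintro _ ⟨p, ⟨hp1, hp2⟩, rfl⟩
    have h : |(Ψ (1, p)).2.2.2 - a| < ε := by
      by_contra h
      have h2 := hΨ.fixOut 1 (Ψ (1, p)) (not_lt.1 h)
      have h3 := (hΨ.bij 1).1 h2
      rw [h3] at h
      exact h hp2
    rw [abs_lt] at h
    exact ⟨by linarith [h.1], by linarith [h.2]⟩
  · rintro _ ⟨p, ⟨⟨z, rfl⟩, hp2, hp3⟩, rfl⟩
    exact hBm z hp3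
end
end

section
/- Let L and L' be flat-at-infinity planar Lagrangians, let P = {(x₁, x₂, 0, 0) : x₁, x₂ ∈ ℝ} be the x₁x₂-plane, and let C, C' ⊆ ℝ⁴ be compact sets with L ∖ C = P ∖ C and L' ∖ C' = P ∖ C'. Let s, s̃, s', s̃' ∈ ℝ satisfy C + (s, 0, 0, 0) ⊆ {x₁ < 0}, C + (s̃, 0, 0, 0) ⊆ {x₁ < 0}, C' + (s', 0, 0, 0) ⊆ {x₁ > 0}, and C' + (s̃', 0, 0, 0) ⊆ {x₁ > 0}. Define the connect sums L # L' = ((L + (s, 0, 0, 0)) ∩ {x₁ ≤ 0}) ∪ ((L' + (s', 0, 0, 0)) ∩ {x₁ ≥ 0}) and L #̃ L' = ((L + (s̃, 0, 0, 0)) ∩ {x₁ ≤ 0}) ∪ ((L' + (s̃', 0, 0, 0)) ∩ {x₁ ≥ 0}). Then there exists a compactly supported area-preserving diffeomorphism φ of ℝ² such that Φ_φ(L # L') = L #̃ L'. (Lemma: the connect sum is independent of the chosen translations.) -/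
noncomputable section

lemma cs_det2 (T : R2 →ₗ[ℝ] R2) :
    LinearMap.det T = (T (1, 0)).1 * (T (0, 1)).2 - (T (0, 1)).1 * (T (1, 0)).2 := by
  rw [← LinearMap.det_toMatrix (Module.Basis.finTwoProd ℝ), Matrix.det_fin_two]
  simp [LinearMap.toMatrix_apply]

lemma cs_inv_smooth (φ : R2 → R2) (hb : Function.Bijective φ) (hc : ContDiff ℝ (⊤ : ℕ∞) φ)
    (hd : ∀ p : R2, LinearMap.det ((fderiv ℝ φ p) : R2 →ₗ[ℝ] R2) ≠ 0) :
    ContDiff ℝ (⊤ : ℕ∞) (Function.invFun φ) := by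
  have hex : ∀ p, ∃ e : R2 ≃L[ℝ] R2, (e : R2 →L[ℝ] R2) = fderiv ℝ φ p := fun p =>
    ⟨(fderiv ℝ φ p).toContinuousLinearEquivOfDetNeZero (hd p), by ext <;> rfl⟩
  choose e he using hex
  have hst : ∀ p, HasStrictFDerivAt φ (e p : R2 →L[ℝ] R2) p := fun p => by
    rw [he]; exact hc.contDiffAt.hasStrictFDerivAt (by simp)
  have hopen : IsOpenMap φ := isOpenMap_iff_nhds_le.2 fun p =>
    ((hst p).map_nhds_eq_of_equiv).ge
  let E := Equiv.ofBijective φ hb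
  let H : R2 ≃ₜ R2 := E.toHomeomorphOfContinuousOpen hc.continuous hopen
  have h := H.contDiff_symm (f₀' := e) (fun a => (hst a).hasFDerivAt) hc
  have : Function.invFun φ = H.symm := by
    funext y
    apply hb.1
    rw [Function.invFun_eq (hb.2 y)]
    exact (H.apply_symm_apply y).symm
  rw [this]; exact h

lemma cs_bij (c : ℝ) (v : ℝ → ℝ) (hv : Differentiable ℝ v)
    (hd : ∀ y, |c * deriv v y| ≤ 1 / 2) : Function.Bijective (fun y => y + c * v y) := by
  have hder : ∀ y, HasDerivAt (fun y => y + c * v y) (1 + c * deriv v y) y := fun y =>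
    (hasDerivAt_id y).add ((hv y).hasDerivAt.const_mul c)
  have hcont : Continuous (fun y => y + c * v y) :=
    continuous_iff_continuousAt.2 fun y => (hder y).continuousAt
  have hmono : Monotone (fun y => y + c * v y - y / 2) := by
    apply monotone_of_hasDerivAt_nonneg (f' := fun y => (1 + c * deriv v y) - 1 / 2)
    · intro y
      exact (hder y).sub ((hasDerivAt_id y).div_const 2)
    · intro y
      have := (abs_le.1 (hd y)).1
      show (0:ℝ) ≤ _
      linarith
  refine ⟨?_, ?_⟩
  · apply StrictMono.injective
    intro a b hab
    have := hmono hab.le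
    simp only at this ⊢
    linarith
  · apply hcont.surjective
    · apply Filter.tendsto_atTop_mono' (f₁ := fun y => c * v 0 + y / 2)
      · filter_upwards [Filter.eventually_ge_atTop 0] with y hy
        have := hmono hy
        simp only at this ⊢
        linarith
      · exact Filter.tendsto_atTop_add_const_left _ _
          (Filter.tendsto_id.atTop_div_const (by norm_num))
    · apply Filter.tendsto_atBot_mono' (f₁ := fun y => c * v 0 + y / 2)
      · filter_upwards [Filter.eventually_le_atBot 0] with y hy
        have := hmono hy
        simp only at this ⊢
        linarith
      · exact Filter.tendsto_atBot_add_const_left _ _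
          (Filter.tendsto_id.atBot_div_const (by norm_num))

/-- Key lemma: generating function S(x,Y) = F(x) g(Y). -/
lemma cs_gen (F g : ℝ → ℝ) (hF : ContDiff ℝ (⊤ : ℕ∞) F) (hg : ContDiff ℝ (⊤ : ℕ∞) g)
    (hb : ∀ x y, |deriv F x * deriv g y| ≤ 1 / 2) :
    ∃ φ : R2 → R2, IsAreaDiffeo φ ∧
      ∀ x y, φ (x, y + deriv F x * g y) = (x + F x * deriv g y, y) := by
  have hF' : ContDiff ℝ (⊤ : ℕ∞) (deriv F) := (contDiff_infty_iff_deriv.1 hF).2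
  have hg' : ContDiff ℝ (⊤ : ℕ∞) (deriv g) := (contDiff_infty_iff_deriv.1 hg).2
  have dF : Differentiable ℝ F := hF.differentiable (by simp)
  have dg : Differentiable ℝ g := hg.differentiable (by simp)
  have dF' : Differentiable ℝ (deriv F) := hF'.differentiable (by simp)
  have dg' : Differentiable ℝ (deriv g) := hg'.differentiable (by simp)
  let A : R2 → R2 := fun p => (p.1, p.2 + deriv F p.1 * g p.2)
  let B : R2 → R2 := fun p => (p.1 + F p.1 * deriv g p.2, p.2)
  have hA : ContDiff ℝ (⊤ : ℕ∞) A := by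
    apply contDiff_fst.prodMk
    exact contDiff_snd.add ((hF'.comp contDiff_fst).mul (hg.comp contDiff_snd))
  have hB : ContDiff ℝ (⊤ : ℕ∞) B := by
    refine ContDiff.prodMk ?_ contDiff_snd
    exact contDiff_fst.add ((hF.comp contDiff_fst).mul (hg'.comp contDiff_snd))
  have bA : Function.Bijective A := by
    constructor
    · rintro ⟨x, y⟩ ⟨x', y'⟩ h
      simp only [A, Prod.mk.injEq] at h
      obtain ⟨rfl, h⟩ := h
      have := (cs_bij (deriv F x) g dg (hb x)).1 h
      simp [this]
    · rintro ⟨x, y⟩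
      obtain ⟨z, hz⟩ := (cs_bij (deriv F x) g dg (hb x)).2 y
      exact ⟨(x, z), by simpa [A] using hz⟩
  have hb2 : ∀ y x, |deriv g y * deriv F x| ≤ 1 / 2 := fun y x => by
    rw [mul_comm]; exact hb x y
  have bB : Function.Bijective B := by
    constructor
    · rintro ⟨x, y⟩ ⟨x', y'⟩ h
      simp only [B, Prod.mk.injEq] at h
      obtain ⟨h, rfl⟩ := h
      have := (cs_bij (deriv g y) F dF (hb2 y)).1 (a₁ := x) (a₂ := x') (by
        simp only; linarith)
      simp [this]
    · rintro ⟨x, y⟩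
      obtain ⟨z, hz⟩ := (cs_bij (deriv g y) F dF (hb2 y)).2 x
      refine ⟨(z, y), ?_⟩
      simp only [B, Prod.mk.injEq, and_true]
      simp only at hz
      linarith
  have detA : ∀ p : R2, LinearMap.det ((fderiv ℝ A p) : R2 →ₗ[ℝ] R2)
      = 1 + deriv F p.1 * deriv g p.2 := by
    intro p
    have h1 := (dF' p.1).hasDerivAt.comp_hasFDerivAt p
      (hasFDerivAt_fst (𝕜 := ℝ) (E := ℝ) (F := ℝ) (p := p))
    have h2 := (dg p.2).hasDerivAt.comp_hasFDerivAt p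
      (hasFDerivAt_snd (𝕜 := ℝ) (E := ℝ) (F := ℝ) (p := p))
    have h := (hasFDerivAt_fst (𝕜 := ℝ) (E := ℝ) (F := ℝ) (p := p)).prodMk
      ((hasFDerivAt_snd (𝕜 := ℝ) (E := ℝ) (F := ℝ) (p := p)).add (h1.mul h2))
    have h' : HasFDerivAt A _ p := h
    rw [h'.fderiv, cs_det2]
    simp
  have detB : ∀ p : R2, LinearMap.det ((fderiv ℝ B p) : R2 →ₗ[ℝ] R2)
      = 1 + deriv F p.1 * deriv g p.2 := by
    intro p
    have h1 := (dF p.1).hasDerivAt.comp_hasFDerivAt p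
      (hasFDerivAt_fst (𝕜 := ℝ) (E := ℝ) (F := ℝ) (p := p))
    have h2 := (dg' p.2).hasDerivAt.comp_hasFDerivAt p
      (hasFDerivAt_snd (𝕜 := ℝ) (E := ℝ) (F := ℝ) (p := p))
    have h := ((hasFDerivAt_fst (𝕜 := ℝ) (E := ℝ) (F := ℝ) (p := p)).add (h1.mul h2)).prodMk
      (hasFDerivAt_snd (𝕜 := ℝ) (E := ℝ) (F := ℝ) (p := p))
    have h' : HasFDerivAt B _ p := h
    rw [h'.fderiv, cs_det2]
    simp [mul_comm]
  have pos : ∀ p : R2, 1 + deriv F p.1 * deriv g p.2 ≠ 0 := fun p => by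
    have := (abs_le.1 (hb p.1 p.2)).1
    linarith
  have iA := cs_inv_smooth A bA hA (fun p => by rw [detA]; exact pos p)
  have li : ∀ p, Function.invFun A (A p) = p := Function.leftInverse_invFun bA.1
  have ri : ∀ p, A (Function.invFun A p) = p := Function.rightInverse_invFun bA.2
  have bi : Function.Bijective (Function.invFun A) :=
    ⟨Function.LeftInverse.injective ri, Function.RightInverse.surjective li⟩
  let φ : R2 → R2 := B ∘ Function.invFun A
  have hφ : ContDiff ℝ (⊤ : ℕ∞) φ := hB.comp iA
  have bφ : Function.Bijective φ := bB.comp bi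
  have hcomp : φ ∘ A = B := by
    funext p; simp [φ, li]
  have dφ : ∀ p : R2, LinearMap.det ((fderiv ℝ φ p) : R2 →ₗ[ℝ] R2) = 1 := by
    intro q
    obtain ⟨p, rfl⟩ := bA.2 q
    have h := fderiv_comp p (hφ.differentiable (by simp) (A p)) (hA.differentiable (by simp) p)
    rw [hcomp] at h
    have h2 := detB p
    rw [h, ContinuousLinearMap.toLinearMap_comp, LinearMap.det_comp, detA] at h2
    exact mul_right_cancel₀ (pos p) (by rw [h2, one_mul])
  refine ⟨φ, ⟨bφ, hφ, cs_inv_smooth φ bφ hφ (fun p => by rw [dφ]; norm_num), dφ⟩, ?_⟩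
  intro x y
  exact congrFun hcomp (x, y)

lemma cs_smooth_iter (φ : R2 → R2) (h : ContDiff ℝ (⊤ : ℕ∞) φ) (n : ℕ) :
    ContDiff ℝ (⊤ : ℕ∞) φ^[n] := by
  induction n with
  | zero => exact contDiff_id
  | succ n ih => exact ih.comp h

lemma cs_iter (φ : R2 → R2) (h : IsAreaDiffeo φ) (n : ℕ) : IsAreaDiffeo (φ^[n]) := by
  have hb : Function.Bijective φ^[n] := h.1.iterate n
  have hc : ContDiff ℝ (⊤ : ℕ∞) φ^[n] := cs_smooth_iter φ h.2.1 n
  have hd : ∀ p : R2, LinearMap.det ((fderiv ℝ φ^[n] p) : R2 →ₗ[ℝ] R2) = 1 := by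
    induction n with
    | zero => intro p; simp [Function.iterate_zero]
    | succ n ih =>
      intro p
      have hcn : ContDiff ℝ (⊤ : ℕ∞) φ^[n] := cs_smooth_iter φ h.2.1 n
      rw [Function.iterate_succ, fderiv_comp p (hcn.differentiable (by simp) _)
        (h.2.1.differentiable (by simp) p), ContinuousLinearMap.toLinearMap_comp,
        LinearMap.det_comp, ih (h.1.iterate n) hcn, h.2.2.2, one_mul]
  exact ⟨hb, hc, cs_inv_smooth _ hb hc (fun p => by rw [hd]; norm_num), hd⟩

lemma cs_bound (F : ℝ → ℝ) (hF : ContDiff ℝ (⊤ : ℕ∞) F) (hs : HasCompactSupport F) :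
    ∃ M, 0 < M ∧ ∀ x, |deriv F x| ≤ M := by
  have hF' : Continuous (deriv F) := hF.continuous_deriv (by simp)
  obtain ⟨M, hM⟩ := hF'.bounded_above_of_compact_support hs.deriv
  exact ⟨|M| + 1, by positivity, fun x => (hM x).trans (by linarith [le_abs_self M])⟩

lemma cs_Q (F : ℝ → ℝ) (hs : HasCompactSupport F) :
    ∃ Q, ∀ x, Q < |x| → F x = 0 ∧ deriv F x = 0 := by
  obtain ⟨Q, hQ⟩ := hs.isCompact.isBounded.exists_norm_le
  refine ⟨Q, fun x hx => ?_⟩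
  have : x ∉ tsupport F := fun h => by
    have := hQ x h; rw [Real.norm_eq_abs] at this; linarith
  exact ⟨image_eq_zero_of_notMem_tsupport this,
    image_eq_zero_of_notMem_tsupport (fun h => this (tsupport_deriv_subset h))⟩

lemma cs_exists (M δ d d' : ℝ) (hδ : 0 < δ) (hM : δ < M) :
    ∃ φ : R2 → R2, IsAreaDiffeo φ ∧ IsCompactSupported φ ∧
      (∀ x y, (φ (x, y)).2 = 0 ↔ y = 0) ∧
      (∀ x y, |y| < M → -M < x → x < -δ → -M < x + d → x + d < -δ → φ (x, y) = (x + d, y)) ∧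
      (∀ x y, |y| < M → δ < x → x < M → δ < x + d' → x + d' < M → φ (x, y) = (x + d', y)) := by
  let bL : ContDiffBump (-(M + δ) / 2 : ℝ) :=
    ⟨(M - δ) / 2, (M - δ) / 2 + δ, by linarith, by linarith⟩
  let bR : ContDiffBump ((M + δ) / 2 : ℝ) :=
    ⟨(M - δ) / 2, (M - δ) / 2 + δ, by linarith, by linarith⟩
  let β : ContDiffBump (0 : ℝ) := ⟨M, M + 1, by linarith, by linarith⟩
  let f : ℝ → ℝ := fun x => d * bL x + d' * bR x
  let g : ℝ → ℝ := fun y => y * β y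
  have hf : ContDiff ℝ (⊤ : ℕ∞) f :=
    (contDiff_const.mul bL.contDiff).add (contDiff_const.mul bR.contDiff)
  have hg : ContDiff ℝ (⊤ : ℕ∞) g := contDiff_id.mul β.contDiff
  have sf : HasCompactSupport f :=
    (bL.hasCompactSupport.mul_left (f := fun _ => d)).add
      (bR.hasCompactSupport.mul_left (f := fun _ => d'))
  have sg : HasCompactSupport g := β.hasCompactSupport.mul_left (f := fun y => y)
  have fL : ∀ x, -M < x → x < -δ → f x = d := by
    intro x h1 h2
    have e1 : bL x = 1 := bL.one_of_mem_closedBall (by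
      rw [Metric.mem_closedBall, Real.dist_eq, abs_le]
      constructor <;> simp only [bL] <;> linarith)
    have e2 : bR x = 0 := bR.zero_of_le_dist (by
      rw [Real.dist_eq, le_abs]; right; simp only [bR]; linarith)
    simp [f, e1, e2]
  have fR : ∀ x, δ < x → x < M → f x = d' := by
    intro x h1 h2
    have e1 : bR x = 1 := bR.one_of_mem_closedBall (by
      rw [Metric.mem_closedBall, Real.dist_eq, abs_le]
      constructor <;> simp only [bR] <;> linarith)
    have e2 : bL x = 0 := bL.zero_of_le_dist (by
      rw [Real.dist_eq, le_abs]; left; simp only [bL]; linarith)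
    simp [f, e1, e2]
  have fL' : ∀ x, -M < x → x < -δ → deriv f x = 0 := by
    intro x h1 h2
    have : f =ᶠ[nhds x] fun _ => d := by
      filter_upwards [Ioo_mem_nhds h1 h2] with z hz using fL z hz.1 hz.2
    rw [this.deriv_eq, deriv_const]
  have fR' : ∀ x, δ < x → x < M → deriv f x = 0 := by
    intro x h1 h2
    have : f =ᶠ[nhds x] fun _ => d' := by
      filter_upwards [Ioo_mem_nhds h1 h2] with z hz using fR z hz.1 hz.2
    rw [this.deriv_eq, deriv_const]
  have g1 : ∀ y, |y| < M → deriv g y = 1 := by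
    intro y hy
    have : g =ᶠ[nhds y] fun z => z := by
      filter_upwards [Ioo_mem_nhds (abs_lt.1 hy).1 (abs_lt.1 hy).2] with z hz
      have : β z = 1 := β.one_of_mem_closedBall (by
        rw [Metric.mem_closedBall, Real.dist_eq, sub_zero]
        exact (abs_lt.2 hz).le)
      simp [g, this]
    rw [this.deriv_eq, deriv_id'']
  have g0 : g 0 = 0 := by simp [g]
  obtain ⟨Mf, hMf, bf⟩ := cs_bound f hf sf
  obtain ⟨Mg, hMg, bg⟩ := cs_bound g hg sg
  obtain ⟨Qf, hQf⟩ := cs_Q f sf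
  obtain ⟨Qg, hQg⟩ := cs_Q g sg
  obtain ⟨N, hN⟩ := exists_nat_gt (2 * (Mf * Mg))
  have hN0 : (0 : ℝ) < N := lt_trans (by positivity) hN
  let F : ℝ → ℝ := fun x => (N : ℝ)⁻¹ * f x
  have hF : ContDiff ℝ (⊤ : ℕ∞) F := contDiff_const.mul hf
  have dF : ∀ x, deriv F x = (N : ℝ)⁻¹ * deriv f x := fun x =>
    deriv_const_mul _ (hf.differentiable (by simp) x)
  have hb : ∀ x y, |deriv F x * deriv g y| ≤ 1 / 2 := by
    intro x y
    rw [dF, mul_assoc, abs_mul, abs_mul, abs_inv, abs_of_pos hN0, inv_mul_le_iff₀ hN0]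
    have := mul_le_mul (bf x) (bg y) (abs_nonneg _) hMf.le
    linarith
  obtain ⟨φ, hφ, hgen⟩ := cs_gen F g hF hg hb
  have hax : ∀ p, (φ p).2 = 0 ↔ p.2 = 0 := by
    rintro ⟨x, y⟩
    obtain ⟨z, hz⟩ := (cs_bij (deriv F x) g (hg.differentiable (by simp)) (hb x)).2 y
    simp only at hz
    rw [← hz, hgen]
    simp only
    constructor
    · rintro rfl; simp [g0]
    · intro h
      exact (cs_bij (deriv F x) g (hg.differentiable (by simp)) (hb x)).1 (by simpa [g0] using h)
  have hsupp : ∀ x y, Qf < |x| ∨ Qg < |y| → φ (x, y) = (x, y) := by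
    rintro x y (h | h)
    · have := hgen x y
      simpa [dF, F, hQf x h] using this
    · have := hgen x y
      simpa [hQg y h] using this
  have hL : ∀ x y, |y| < M → -M < x → x < -δ → φ (x, y) = (x + d / N, y) := by
    intro x y hy h1 h2
    have := hgen x y
    rw [dF, fL' x h1 h2, g1 y hy] at this
    simp only [F, fL x h1 h2, mul_zero, zero_mul, add_zero, mul_one] at this
    rw [this, div_eq_inv_mul]
  have hR : ∀ x y, |y| < M → δ < x → x < M → φ (x, y) = (x + d' / N, y) := by
    intro x y hy h1 h2
    have := hgen x y
    rw [dF, fR' x h1 h2, g1 y hy] at this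
    simp only [F, fR x h1 h2, mul_zero, zero_mul, add_zero, mul_one] at this
    rw [this, div_eq_inv_mul]
  have conv : ∀ (a b x e : ℝ), a < x → x < b → a < x + e → x + e < b → ∀ k : ℕ, k ≤ N →
      a < x + k * (e / N) ∧ x + k * (e / N) < b := by
    intro a b x e h1 h2 h3 h4 k hk
    have hk' : (k : ℝ) ≤ N := by exact_mod_cast hk
    have t0 : 0 ≤ (k : ℝ) / N := by positivity
    have t1 : (k : ℝ) / N ≤ 1 := by rw [div_le_one hN0]; exact hk'
    have he : (k : ℝ) * (e / N) = (k / N) * e := by ring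
    rw [he]
    generalize (k : ℝ) / N = t at t0 t1
    rcases le_total 0 e with h | h
    · have u1 : 0 ≤ t * e := mul_nonneg t0 h
      have u2 : t * e ≤ e := by nlinarith
      constructor <;> linarith
    · have u1 : t * e ≤ 0 := mul_nonpos_of_nonneg_of_nonpos t0 h
      have u2 : e ≤ t * e := by nlinarith
      constructor <;> linarith
  have hNe : ∀ e : ℝ, (N : ℝ) * (e / N) = e := fun e => by field_simp
  refine ⟨φ^[N], cs_iter φ hφ N, ?_, ?_, ?_, ?_⟩
  · refine ⟨Set.Icc (-Qf) Qf ×ˢ Set.Icc (-Qg) Qg, isCompact_Icc.prod isCompact_Icc, ?_⟩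
    rintro ⟨x, y⟩ hp
    apply Function.iterate_fixed
    apply hsupp
    by_contra! h
    exact hp ⟨abs_le.1 h.1, abs_le.1 h.2⟩
  · intro x y
    have : ∀ n p, (φ^[n] p).2 = 0 ↔ p.2 = 0 := by
      intro n
      induction n with
      | zero => intro p; rfl
      | succ n ih => intro p; rw [Function.iterate_succ_apply, ih, hax]
    exact this N (x, y)
  · intro x y hy h1 h2 h3 h4
    have : ∀ k : ℕ, k ≤ N → φ^[k] (x, y) = (x + k * (d / N), y) := by
      intro k
      induction k with
      | zero => intro _; simp
      | succ k ih =>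
        intro hk
        have c := conv _ _ x d h1 h2 h3 h4 k (by omega)
        rw [Function.iterate_succ_apply', ih (by omega), hL _ _ hy c.1 c.2]
        push_cast
        congr 1
        ring
    rw [this N le_rfl, hNe]
  · intro x y hy h1 h2 h3 h4
    have : ∀ k : ℕ, k ≤ N → φ^[k] (x, y) = (x + k * (d' / N), y) := by
      intro k
      induction k with
      | zero => intro _; simp
      | succ k ih =>
        intro hk
        have c := conv _ _ x d' h1 h2 h3 h4 k (by omega)
        rw [Function.iterate_succ_apply', ih (by omega), hR _ _ hy c.1 c.2]
        push_cast
        congr 1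
        ring
    rw [this N le_rfl, hNe]

lemma cs_compact (C : Set R4) (hC : IsCompact C) : ∃ M : ℝ, ∀ p ∈ C, |p.1| ≤ M ∧ |p.2.2.1| ≤ M := by
  obtain ⟨M, hM⟩ := hC.isBounded.exists_norm_le
  refine ⟨M, fun p hp => ⟨(norm_fst_le p).trans (hM p hp), ?_⟩⟩
  exact (norm_fst_le p.2.2).trans ((norm_snd_le p.2).trans ((norm_snd_le p).trans (hM p hp)))

lemma cs_gap (C : Set R4) (hC : IsCompact C) (g : R4 → ℝ) (hg : Continuous g)
    (h : ∀ p ∈ C, 0 < g p) : ∃ δ > 0, ∀ p ∈ C, δ < g p := by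
  rcases C.eq_empty_or_nonempty with rfl | hne
  · exact ⟨1, one_pos, by simp⟩
  · obtain ⟨q, hq, hmin⟩ := hC.exists_isMinOn hne hg.continuousOn
    refine ⟨g q / 2, half_pos (h q hq), fun p hp => ?_⟩
    have h1 : g q ≤ g p := hmin hp
    have := h q hq
    linarith

lemma cs_desc (L L' C C' : Set R4) 
    (hLC : L \ C = {p : R4 | p.2.2 = ((0 : ℝ), (0 : ℝ))} \ C)
    (hL'C' : L' \ C' = {p : R4 | p.2.2 = ((0 : ℝ), (0 : ℝ))} \ C')
    (s s' : ℝ) (hs : ∀ p ∈ C, p.1 + s < 0) (hs' : ∀ p ∈ C', 0 < p.1 + s') (q : R4) :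
    q ∈ (trX1 s '' L ∩ {p : R4 | p.1 ≤ 0}) ∪ (trX1 s' '' L' ∩ {p : R4 | 0 ≤ p.1}) ↔
      (trX1 (-s) q ∈ C ∧ trX1 (-s) q ∈ L) ∨ (trX1 (-s') q ∈ C' ∧ trX1 (-s') q ∈ L') ∨
      (trX1 (-s) q ∉ C ∧ trX1 (-s') q ∉ C' ∧ q.2.2 = ((0 : ℝ), (0 : ℝ))) := by
  have im : ∀ (t : ℝ) (S : Set R4), q ∈ trX1 t '' S ↔ trX1 (-t) q ∈ S := by
    intro t S
    constructor
    · rintro ⟨p, hp, rfl⟩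
      simpa [trX1] using hp
    · intro h
      exact ⟨_, h, by simp [trX1]⟩
  have a := Set.ext_iff.1 hLC (trX1 (-s) q)
  have a' := Set.ext_iff.1 hL'C' (trX1 (-s') q)
  have b := hs (trX1 (-s) q)
  have b' := hs' (trX1 (-s') q)
  rw [Set.mem_union, Set.mem_inter_iff, Set.mem_inter_iff, im, im]
  have e : ∀ t, (trX1 t q).2.2 = q.2.2 := fun t => rfl
  have e1 : ∀ t, (trX1 (-t) q).1 + t = q.1 := fun t => by simp [trX1]
  rw [e1] at b b'
  simp only [Set.mem_sdiff, Set.mem_ofPred_eq, e] at a a' ⊢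
  generalize trX1 (-s) q = u at *
  generalize trX1 (-s') q = u' at *
  rcases lt_trichotomy q.1 0 with h | h | h
  · have h1 : q.1 ≤ 0 := h.le
    have h2 : ¬ 0 ≤ q.1 := not_le.2 h
    have h3 : ¬ 0 < q.1 := not_lt.2 h1
    tauto
  · simp only [h, lt_irrefl, le_refl] at *
    tauto
  · have h1 : 0 ≤ q.1 := h.le
    have h2 : ¬ q.1 ≤ 0 := not_le.2 h
    have h3 : ¬ q.1 < 0 := not_lt.2 h1
    tauto

/-- The connect sum of flat-at-infinity planar Lagrangians is independent of the
    chosen translations, up to a compactly supported area-preserving diffeomorphism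
    of the x₁y₁-plane. -/
theorem connect_sum_well_defined (L L' : Set R4)
    (hL : IsFlatLagrangian L) (hL' : IsFlatLagrangian L')
    (C C' : Set R4) (hC : IsCompact C) (hC' : IsCompact C')
    (hLC : L \ C = {p : R4 | p.2.2 = ((0 : ℝ), (0 : ℝ))} \ C)
    (hL'C' : L' \ C' = {p : R4 | p.2.2 = ((0 : ℝ), (0 : ℝ))} \ C')
    (s st s' st' : ℝ)
    (hs : trX1 s '' C ⊆ {p : R4 | p.1 < 0}) (hst : trX1 st '' C ⊆ {p : R4 | p.1 < 0})
    (hs' : trX1 s' '' C' ⊆ {p : R4 | p.1 > 0}) (hst' : trX1 st' '' C' ⊆ {p : R4 | p.1 > 0}) :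
    ∃ φ : R2 → R2, IsAreaDiffeo φ ∧ IsCompactSupported φ ∧
      PhiPhi φ '' ((trX1 s '' L ∩ {p : R4 | p.1 ≤ 0}) ∪ (trX1 s' '' L' ∩ {p : R4 | 0 ≤ p.1}))
        = (trX1 st '' L ∩ {p : R4 | p.1 ≤ 0}) ∪ (trX1 st' '' L' ∩ {p : R4 | 0 ≤ p.1}) := by
  have ks : ∀ p ∈ C, p.1 + s < 0 := fun p hp => hs ⟨p, hp, rfl⟩
  have kst : ∀ p ∈ C, p.1 + st < 0 := fun p hp => hst ⟨p, hp, rfl⟩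
  have ks' : ∀ p ∈ C', 0 < p.1 + s' := fun p hp => hs' ⟨p, hp, rfl⟩
  have kst' : ∀ p ∈ C', 0 < p.1 + st' := fun p hp => hst' ⟨p, hp, rfl⟩
  obtain ⟨M1, hM1⟩ := cs_compact C hC
  obtain ⟨M2, hM2⟩ := cs_compact C' hC'
  obtain ⟨δ1, p1, h1⟩ := cs_gap C hC (fun p => -(p.1 + s)) (by fun_prop)
    (fun p hp => neg_pos.2 (ks p hp))
  obtain ⟨δ2, p2, h2⟩ := cs_gap C hC (fun p => -(p.1 + st)) (by fun_prop)
    (fun p hp => neg_pos.2 (kst p hp))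
  obtain ⟨δ3, p3, h3⟩ := cs_gap C' hC' (fun p => (p.1 + s')) (by fun_prop) ks'
  obtain ⟨δ4, p4, h4⟩ := cs_gap C' hC' (fun p => (p.1 + st')) (by fun_prop) kst'
  obtain ⟨δ, hδ, l1, l2, l3, l4⟩ : ∃ δ > 0, δ ≤ δ1 ∧ δ ≤ δ2 ∧ δ ≤ δ3 ∧ δ ≤ δ4 :=
    ⟨min (min δ1 δ2) (min δ3 δ4), by positivity, by simp, by simp, by simp, by simp⟩
  obtain ⟨M, hM⟩ : ∃ M, M = |M1| + |M2| + |s| + |st| + |s'| + |st'| + δ + 1 := ⟨_, rfl⟩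
  have n1 := abs_nonneg M1
  have n2 := abs_nonneg M2
  have n3 := abs_nonneg s
  have n4 := abs_nonneg st
  have n5 := abs_nonneg s'
  have n6 := abs_nonneg st'
  obtain ⟨φ, hφ, hcs, hax, hL1, hR1⟩ := cs_exists M δ (st - s) (st' - s') hδ (by linarith)
  refine ⟨φ, hφ, hcs, ?_⟩
  have tL : ∀ p ∈ C, PhiPhi φ (trX1 s p) = trX1 st p := by
    intro p hp
    obtain ⟨q1, q2⟩ := hM1 p hp
    have r1 := h1 p hp
    have r2 := h2 p hp
    have := hL1 (p.1 + s) p.2.2.1 (by linarith [le_abs_self M1])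
      (by linarith [neg_abs_le p.1, neg_abs_le s, le_abs_self M1]) (by linarith)
      (by linarith [neg_abs_le p.1, neg_abs_le st, le_abs_self M1]) (by linarith)
    simp only [PhiPhi, trX1, this, Prod.mk.injEq, and_true]
    ring
  have tR : ∀ p ∈ C', PhiPhi φ (trX1 s' p) = trX1 st' p := by
    intro p hp
    obtain ⟨q1, q2⟩ := hM2 p hp
    have r1 := h3 p hp
    have r2 := h4 p hp
    have := hR1 (p.1 + s') p.2.2.1 (by linarith [le_abs_self M2])
      (by linarith) (by linarith [le_abs_self p.1, le_abs_self s', le_abs_self M2])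
      (by linarith) (by linarith [le_abs_self p.1, le_abs_self st', le_abs_self M2])
    simp only [PhiPhi, trX1, this, Prod.mk.injEq, and_true]
    ring
  have inj : Function.Injective (PhiPhi φ) := by
    rintro ⟨a, b, c, e⟩ ⟨a', b', c', e'⟩ h
    simp only [PhiPhi, Prod.mk.injEq] at h
    have := hφ.1.1 (Prod.ext h.1 h.2.2.1)
    simp only [Prod.mk.injEq] at this
    simp [this, h.2.1, h.2.2.2]
  have surj : Function.Surjective (PhiPhi φ) := by
    rintro ⟨a, b, c, e⟩
    obtain ⟨⟨x, y⟩, h⟩ := hφ.1.2 (a, c)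
    exact ⟨(x, b, y, e), by simp [PhiPhi, h]⟩
  have inv1 : ∀ t p, trX1 (-t) (trX1 t p) = p := fun t p => by simp [trX1]
  have inv2 : ∀ t p, trX1 t (trX1 (-t) p) = p := fun t p => by simp [trX1]
  have key : ∀ (D : Set R4) (t t' : ℝ), (∀ p ∈ D, PhiPhi φ (trX1 t p) = trX1 t' p) →
      ∀ (E : Set R4) (q : R4), (trX1 (-t') (PhiPhi φ q) ∈ D ∧ trX1 (-t') (PhiPhi φ q) ∈ E) ↔
        (trX1 (-t) q ∈ D ∧ trX1 (-t) q ∈ E) := by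
    intro D t t' hD E q
    have fwd : trX1 (-t) q ∈ D → trX1 (-t') (PhiPhi φ q) = trX1 (-t) q := by
      intro h
      have := hD _ h
      rw [inv2] at this
      rw [this, inv1]
    have bwd : trX1 (-t') (PhiPhi φ q) ∈ D → trX1 (-t) q ∈ D := by
      intro h
      have := hD _ h
      rw [inv2] at this
      rw [← inj this, inv1]
      exact h
    constructor
    · rintro ⟨u, v⟩
      have w := fwd (bwd u)
      rw [w] at u v
      exact ⟨u, v⟩
    · rintro ⟨u, v⟩
      rw [fwd u]
      exact ⟨u, v⟩
  have main : ∀ q, PhiPhi φ q ∈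
      (trX1 st '' L ∩ {p : R4 | p.1 ≤ 0}) ∪ (trX1 st' '' L' ∩ {p : R4 | 0 ≤ p.1}) ↔
      q ∈ (trX1 s '' L ∩ {p : R4 | p.1 ≤ 0}) ∪ (trX1 s' '' L' ∩ {p : R4 | 0 ≤ p.1}) := by
    intro q
    rw [cs_desc L L' C C' hLC hL'C' st st' kst kst', cs_desc L L' C C' hLC hL'C' s s' ks ks',
      key C s st tL, key C' s' st' tR]
    have k1 := key C s st tL C q
    have k2 := key C' s' st' tR C' q
    rw [and_self, and_self] at k1 k2
    have k3 : (PhiPhi φ q).2.2 = ((0 : ℝ), (0 : ℝ)) ↔ q.2.2 = ((0 : ℝ), (0 : ℝ)) := by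
      obtain ⟨a, b, c, e⟩ := q
      simp only [PhiPhi, Prod.mk.injEq, hax]
    rw [k1, k2, k3]
  ext q
  obtain ⟨p, rfl⟩ := surj q
  rw [main, inj.mem_set_image]
end
end
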